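/- Theorem 3, part 2 (consistent origination dating, t-type statistic). Under the bubble model with Assumptions A1 and A2 and the initial-value condition, let (cv_n) be positive thresholds satisfying 1/cv_n + cv_n/n^{1−α/2} → 0 as n → ∞ (so cv_n → ∞ and cv_n = o(n^{1−α/2})). Then the estimated origination fraction r̂_e := inf{ s ∈ [r_0,1] : SV-ADF^t_{⌊ns⌋} > cv_n } (with inf ∅ := 1) converges in probability to the true origination fraction r_e as n → ∞. -/

import Mathlib

open MeasureTheory ProbabilityTheory Filter

/-- The average innovation variance `m_{n,k} = k⁻¹ Σ_{t=1}^k E[σ_t²]`. -/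
noncomputable def avgVar {Ω : Type*} [MeasurableSpace Ω] (P : ℕ → Measure Ω)
    (σ : ℕ → ℕ → Ω → ℝ) (n k : ℕ) : ℝ :=
  (∑ t ∈ Finset.Icc 1 k, ∫ ω, (σ n t ω) ^ 2 ∂(P n)) / k

/-- Recursive sample mean `X̄_τ = τ⁻¹ Σ_{k=1}^τ X_{k-1}`. -/
noncomputable def xbar {Ω : Type*} (X : ℕ → Ω → ℝ) (τ : ℕ) (ω : Ω) : ℝ :=
  (∑ k ∈ Finset.Icc 1 τ, X (k - 1) ω) / τ

/-- Demeaned observation `X̃_j = X_j - X̄_τ`. -/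
noncomputable def xtil {Ω : Type*} (X : ℕ → Ω → ℝ) (τ j : ℕ) (ω : Ω) : ℝ :=
  X j ω - xbar X τ ω

/-- OLS slope `δ̂(τ) = (Σ_{j=1}^τ X̃_{j-1} X_j)/(Σ_{j=1}^τ X̃_{j-1}²)`. -/
noncomputable def deltaHat {Ω : Type*} (X : ℕ → Ω → ℝ) (τ : ℕ) (ω : Ω) : ℝ :=
  (∑ j ∈ Finset.Icc 1 τ, xtil X τ (j - 1) ω * X j ω) /
    ∑ j ∈ Finset.Icc 1 τ, (xtil X τ (j - 1) ω) ^ 2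

/-- Coefficient-based recursive statistic `SV-ADF^δ_τ = τ (δ̂(τ) - 1)`. -/
noncomputable def svadfDelta {Ω : Type*} (X : ℕ → Ω → ℝ) (τ : ℕ) (ω : Ω) : ℝ :=
  (τ : ℝ) * (deltaHat X τ ω - 1)

/-- Residual variance `σ̂²_τ = τ⁻¹ Σ_{j=1}^τ (X̃_j - δ̂(τ) X̃_{j-1})²`. -/
noncomputable def sigmaHatSq {Ω : Type*} (X : ℕ → Ω → ℝ) (τ : ℕ) (ω : Ω) : ℝ :=
  (∑ j ∈ Finset.Icc 1 τ, (xtil X τ j ω - deltaHat X τ ω * xtil X τ (j - 1) ω) ^ 2) / τ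

/-- t-type recursive statistic
`SV-ADF^t_τ = (Σ_{j=1}^τ X̃_{j-1}² / σ̂²_τ)^{1/2} (δ̂(τ) - 1)`. -/
noncomputable def svadfT {Ω : Type*} (X : ℕ → Ω → ℝ) (τ : ℕ) (ω : Ω) : ℝ :=
  Real.sqrt ((∑ j ∈ Finset.Icc 1 τ, (xtil X τ (j - 1) ω) ^ 2) / sigmaHatSq X τ ω) *
    (deltaHat X τ ω - 1)

/-- Estimated origination fraction:
`r̂_e = inf { s ∈ [r₀, 1] : stat_{⌊ns⌋} > cv }`, with `inf ∅ := 1` (implemented by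
adjoining `{1}` to the set, which does not change the infimum when the set of
crossing times in `[r₀,1]` is nonempty). -/
noncomputable def rHatE {Ω : Type*} (stat : ℕ → Ω → ℝ) (n : ℕ) (r0 cv : ℝ)
    (ω : Ω) : ℝ :=
  sInf ({s : ℝ | s ∈ Set.Icc r0 1 ∧ cv < stat ⌊(n : ℝ) * s⌋₊ ω} ∪ {1})


/-- Filtration with Gaussian shocks and predictable volatilities up to time `N`. -/
structure GS {Ω : Type*} [mΩ : MeasurableSpace Ω] (μ : Measure Ω) (ℱ : ℕ → MeasurableSpace Ω)
    (N : ℕ) (v ε : ℕ → Ω → ℝ) : Prop where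
  mono : Monotone ℱ
  le : ∀ t, ℱ t ≤ mΩ
  vmeas : ∀ t, 1 ≤ t → t ≤ N → Measurable[ℱ (t - 1)] (v t)
  emeas : ∀ t, Measurable (ε t)
  gauss : ∀ t, 1 ≤ t → t ≤ N → Measure.map (ε t) μ = gaussianReal 0 1
  indep : ∀ t, 1 ≤ t → t ≤ N →
    Indep (MeasurableSpace.comap (ε t) inferInstance) (ℱ (t - 1)) μ
  adapted : ∀ t, 1 ≤ t → t ≤ N → Measurable[ℱ t] (fun ω => v t ω * ε t ω)

theorem one_step {Ω β : Type*} (m : MeasurableSpace Ω) [mΩ : MeasurableSpace Ω]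
    [mβ : MeasurableSpace β] (μ : Measure Ω) [IsProbabilityMeasure μ] (hm : m ≤ mΩ)
    (W : Ω → β) (hW : Measurable[m] W) (e : Ω → ℝ) (he : Measurable e)
    (hg : Measure.map e μ = gaussianReal 0 1)
    (hi : Indep (MeasurableSpace.comap e inferInstance) m μ)
    (g : β × ℝ → ENNReal) (hgm : Measurable g) :
    ∫⁻ ω, g (W ω, e ω) ∂μ = ∫⁻ ω, ∫⁻ x, g (W ω, x) ∂(gaussianReal 0 1) ∂μ := by
  have hW' : Measurable W := hW.mono hm le_rfl
  have hind : IndepFun W e μ := by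
    rw [IndepFun_iff_Indep]
    exact (indep_of_indep_of_le_right hi hW.comap_le).symm
  have h1 := (indepFun_iff_map_prod_eq_prod_map_map hW'.aemeasurable he.aemeasurable).1 hind
  rw [← lintegral_map (f := g) (g := fun ω => (W ω, e ω)) hgm (hW'.prodMk he), h1, hg,
    lintegral_prod _ hgm.aemeasurable]
  rw [lintegral_map (f := fun w => ∫⁻ x, g (w, x) ∂(gaussianReal 0 1)) _ hW']
  exact hgm.lintegral_prod_right'

theorem gauss_exp (y v q : ℝ) (hq : 0 < q) :
    ∫⁻ x, ENNReal.ofReal (Real.exp (-(y + v * x) ^ 2 / (2 * q))) ∂(gaussianReal 0 1) =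
      ENNReal.ofReal (Real.sqrt (q / (q + v ^ 2)) * Real.exp (-y ^ 2 / (2 * (q + v ^ 2)))) := by
  have hqv : 0 < q + v ^ 2 := by positivity
  have hb : 0 < (q + v ^ 2) / (2 * q) := by positivity
  have key : ∀ x : ℝ, gaussianPDFReal 0 1 x * Real.exp (-(y + v * x) ^ 2 / (2 * q)) =
      ((Real.sqrt (2 * Real.pi))⁻¹ * Real.exp (-y ^ 2 / (2 * (q + v ^ 2)))) *
        Real.exp (-((q + v ^ 2) / (2 * q)) * (x + y * v / (q + v ^ 2)) ^ 2) := by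
    intro x
    rw [gaussianPDFReal]
    simp only [NNReal.coe_one, mul_one, sub_zero]
    rw [mul_assoc, mul_assoc, ← Real.exp_add, ← Real.exp_add]
    congr 2
    field_simp
    ring
  rw [gaussianReal_of_var_ne_zero 0 one_ne_zero,
    lintegral_withDensity_eq_lintegral_mul _ (measurable_gaussianPDF 0 1) (by fun_prop)]
  have h2 : ∀ x : ℝ, (gaussianPDF 0 1 *
      fun x => ENNReal.ofReal (Real.exp (-(y + v * x) ^ 2 / (2 * q)))) x =
      ENNReal.ofReal (((Real.sqrt (2 * Real.pi))⁻¹ * Real.exp (-y ^ 2 / (2 * (q + v ^ 2)))) *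
        Real.exp (-((q + v ^ 2) / (2 * q)) * (x + y * v / (q + v ^ 2)) ^ 2)) := by
    intro x
    rw [← key, Pi.mul_apply, gaussianPDF, ENNReal.ofReal_mul (gaussianPDFReal_nonneg _ _ _)]
  simp_rw [h2]
  have hIntg : Integrable (fun x : ℝ =>
      Real.exp (-((q + v ^ 2) / (2 * q)) * (x + y * v / (q + v ^ 2)) ^ 2)) :=
    (integrable_exp_neg_mul_sq hb).comp_add_right (y * v / (q + v ^ 2))
  rw [← ofReal_integral_eq_lintegral_ofReal (hIntg.const_mul _)
    (Eventually.of_forall fun x => by positivity)]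
  congr 1
  rw [integral_const_mul, integral_add_right_eq_self
    (fun x : ℝ => Real.exp (-((q + v ^ 2) / (2 * q)) * x ^ 2)), integral_gaussian]
  rw [mul_right_comm]
  congr 1
  rw [← Real.sqrt_inv, ← Real.sqrt_mul (by positivity)]
  congr 1
  have := Real.pi_pos
  field_simp

theorem gauss_sq (y v : ℝ) :
    ∫⁻ x, ENNReal.ofReal ((y + v * x) ^ 2) ∂(gaussianReal 0 1) =
      ENNReal.ofReal (y ^ 2 + v ^ 2) := by
  have i1 : Integrable (fun x : ℝ => x) (gaussianReal 0 1) := by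
    exact (memLp_id_gaussianReal (μ := 0) (v := 1) 1).integrable (by simp)
  have i2 : Integrable (fun x : ℝ => x ^ 2) (gaussianReal 0 1) := by
    simpa using (memLp_id_gaussianReal (μ := 0) (v := 1) 2).integrable_sq
  have e1 : ∫ x, x ∂(gaussianReal 0 1) = 0 := integral_id_gaussianReal
  have e2 : ∫ x, x ^ 2 ∂(gaussianReal 0 1) = 1 := by
    have := variance_id_gaussianReal (μ := 0) (v := 1)
    rw [variance_eq_integral (by fun_prop)] at this
    simpa [e1] using this
  have hexp : (fun x : ℝ => (y + v * x) ^ 2) = fun x => y ^ 2 + 2 * y * v * x + v ^ 2 * x ^ 2 := by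
    funext x; ring
  have i3 : Integrable (fun x : ℝ => y ^ 2 + 2 * y * v * x) (gaussianReal 0 1) :=
    (integrable_const _).add (i1.const_mul _)
  have hIntg : Integrable (fun x : ℝ => (y + v * x) ^ 2) (gaussianReal 0 1) := by
    rw [hexp]; exact i3.add (i2.const_mul _)
  rw [← ofReal_integral_eq_lintegral_ofReal hIntg (Eventually.of_forall fun x => by positivity)]
  congr 1
  rw [hexp, integral_add i3 (i2.const_mul _), integral_add (integrable_const _) (i1.const_mul _),
    integral_const_mul, integral_const_mul, e1, e2]
  simp

namespace GS

variable {Ω : Type*} [mΩ : MeasurableSpace Ω] {μ : Measure Ω} {ℱ : ℕ → MeasurableSpace Ω}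
    {N : ℕ} {v ε : ℕ → Ω → ℝ}

theorem scale (h : GS μ ℱ N v ε) (w : ℕ → ℝ) : GS μ ℱ N (fun t ω => w t * v t ω) ε where
  mono := h.mono
  le := h.le
  vmeas := fun t h1 h2 => (h.vmeas t h1 h2).const_mul (w t)
  emeas := h.emeas
  gauss := h.gauss
  indep := h.indep
  adapted := fun t h1 h2 => by
    have := (h.adapted t h1 h2).const_mul (w t)
    simpa only [mul_assoc] using this

theorem shrink (h : GS μ ℱ N v ε) {M : ℕ} (hM : M ≤ N) : GS μ ℱ M v ε where
  mono := h.mono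
  le := h.le
  vmeas := fun t h1 h2 => h.vmeas t h1 (h2.trans hM)
  emeas := h.emeas
  gauss := fun t h1 h2 => h.gauss t h1 (h2.trans hM)
  indep := fun t h1 h2 => h.indep t h1 (h2.trans hM)
  adapted := fun t h1 h2 => h.adapted t h1 (h2.trans hM)

theorem step (h : GS μ ℱ N v ε) [IsProbabilityMeasure μ] {β : Type*} [MeasurableSpace β] {t : ℕ}
    (ht : t + 1 ≤ N) (W : Ω → β) (hW : Measurable[ℱ t] W)
    (g : β × ℝ → ENNReal) (hgm : Measurable g) :
    ∫⁻ ω, g (W ω, ε (t + 1) ω) ∂μ = ∫⁻ ω, ∫⁻ x, g (W ω, x) ∂(gaussianReal 0 1) ∂μ :=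
  one_step (ℱ t) μ (h.le t) W hW _ (h.emeas _) (h.gauss _ (by omega) ht)
    (h.indep (t + 1) (by omega) ht) g hgm

theorem vmeas' (h : GS μ ℱ N v ε) {i t : ℕ} (h1 : 1 ≤ i) (h2 : i ≤ t + 1) (h3 : i ≤ N) :
    Measurable[ℱ t] (v i) :=
  (h.vmeas i h1 h3).mono (h.mono (by omega)) le_rfl

theorem umeas' (h : GS μ ℱ N v ε) {i t : ℕ} (h1 : 1 ≤ i) (h2 : i ≤ t) (h3 : i ≤ N) :
    Measurable[ℱ t] (fun ω => v i ω * ε i ω) :=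
  (h.adapted i h1 h3).mono (h.mono (by omega)) le_rfl

/-- partial sums are adapted -/
theorem summeas (h : GS μ ℱ N v ε) {s t : ℕ} (hst : s ≤ t) (hs : s ≤ N) :
    Measurable[ℱ t] (fun ω => ∑ i ∈ Finset.Icc 1 s, v i ω * ε i ω) := by
  refine Finset.measurable_fun_sum _ fun i hi => ?_
  rw [Finset.mem_Icc] at hi
  exact h.umeas' hi.1 (hi.2.trans hst) (hi.2.trans hs)

theorem sqsummeas (h : GS μ ℱ N v ε) {s t : ℕ} (hst : s ≤ t + 1) (hs : s ≤ N) :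
    Measurable[ℱ t] (fun ω => ∑ i ∈ Finset.Icc 1 s, v i ω ^ 2) := by
  refine Finset.measurable_fun_sum _ fun i hi => ?_
  rw [Finset.mem_Icc] at hi
  exact (h.vmeas' hi.1 (hi.2.trans hst) (hi.2.trans hs)).pow_const 2

theorem usqsummeas (h : GS μ ℱ N v ε) {s t : ℕ} (hst : s ≤ t) (hs : s ≤ N) :
    Measurable[ℱ t] (fun ω => ∑ i ∈ Finset.Icc 1 s, (v i ω * ε i ω) ^ 2) := by
  refine Finset.measurable_fun_sum _ fun i hi => ?_
  rw [Finset.mem_Icc] at hi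
  exact (h.umeas' hi.1 (hi.2.trans hst) (hi.2.trans hs)).pow_const 2

end GS

theorem prod_ge_one_add_sum (s : Finset ℕ) (x : ℕ → ℝ) (hx : ∀ i, 0 ≤ x i) :
    1 + ∑ i ∈ s, x i ≤ ∏ i ∈ s, (1 + x i) := by
  induction s using Finset.induction_on with
  | empty => simp
  | insert a s ha ih =>
    rw [Finset.sum_insert ha, Finset.prod_insert ha]
    have h1 : 0 ≤ ∑ i ∈ s, x i := Finset.sum_nonneg fun i _ => hx i
    have := hx a
    nlinarith [mul_nonneg this h1]

namespace GS

variable {Ω : Type*} [mΩ : MeasurableSpace Ω] {μ : Measure Ω} {ℱ : ℕ → MeasurableSpace Ω}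
    {N : ℕ} {v ε : ℕ → Ω → ℝ}

theorem anticonc (h : GS μ ℱ N v ε) [IsProbabilityMeasure μ] (Y0 : Ω → ℝ)
    (hY0 : Measurable[ℱ 0] Y0) (a b : ℝ) (ha : 0 < a) (hb : 0 < b) :
    μ {ω | |Y0 ω + ∑ i ∈ Finset.Icc 1 N, v i ω * ε i ω| ≤ a ∧
      |∑ i ∈ Finset.Icc 1 N, v i ω ^ 2 - b| ≤ a ^ 2} ≤ ENNReal.ofReal (3 * a / Real.sqrt b) := by
  classical
  set H : ℝ × ℝ → ENNReal := fun p => if a ^ 2 ≤ p.2 then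
    ENNReal.ofReal (1 / Real.sqrt p.2 * Real.exp (-p.1 ^ 2 / (2 * p.2))) else 0 with hH
  have hHm : Measurable H := by
    refine Measurable.ite (measurableSet_le measurable_const measurable_snd) ?_ measurable_const
    fun_prop
  have ha2 : 0 < a ^ 2 := by positivity
  -- one-step Gaussian inequality
  have hstep : ∀ y B w : ℝ, ∫⁻ x, H (y + w * x, B - w ^ 2) ∂(gaussianReal 0 1) ≤ H (y, B) := by
    intro y B w
    by_cases hc : a ^ 2 ≤ B - w ^ 2
    · have hq : 0 < B - w ^ 2 := lt_of_lt_of_le ha2 hc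
      have hB : a ^ 2 ≤ B := by nlinarith [sq_nonneg w]
      have hB0 : 0 < B := lt_of_lt_of_le ha2 hB
      simp only [hH, hc, hB, if_true]
      simp_rw [ENNReal.ofReal_mul (show 0 ≤ 1 / Real.sqrt (B - w ^ 2) by positivity)]
      rw [lintegral_const_mul _ (by fun_prop), gauss_exp _ _ _ hq, ← ENNReal.ofReal_mul (by positivity)]
      refine le_of_eq ?_
      congr 1
      rw [sub_add_cancel, ← mul_assoc]
      congr 1
      rw [Real.sqrt_div hq.le]
      have : Real.sqrt (B - w ^ 2) ≠ 0 := (Real.sqrt_pos.2 hq).ne'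
      field_simp
    · simp [hH, hc]
  set Y : ℕ → Ω → ℝ := fun t ω => Y0 ω + ∑ i ∈ Finset.Icc 1 t, v i ω * ε i ω with hY
  set Q : ℕ → Ω → ℝ := fun t ω => b + 2 * a ^ 2 - ∑ i ∈ Finset.Icc 1 t, v i ω ^ 2 with hQ
  have hYm : ∀ t, t ≤ N → Measurable[ℱ t] (Y t) := fun t ht =>
    (hY0.mono (h.mono (Nat.zero_le t)) le_rfl).add (h.summeas le_rfl ht)
  have hQm : ∀ t, t ≤ N → Measurable[ℱ t] (Q t) := fun t ht =>
    (h.sqsummeas (Nat.le_succ t) ht).const_sub _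
  have hdec : ∀ t, t ≤ N → ∫⁻ ω, H (Y t ω, Q t ω) ∂μ ≤ ENNReal.ofReal (1 / Real.sqrt b) := by
    intro t
    induction t with
    | zero =>
      intro _
      calc ∫⁻ ω, H (Y 0 ω, Q 0 ω) ∂μ ≤ ∫⁻ _, ENNReal.ofReal (1 / Real.sqrt b) ∂μ := by
            refine lintegral_mono fun ω => ?_
            simp only [hH, hQ]
            simp only [Finset.Icc_eq_empty_of_lt Nat.zero_lt_one, Finset.sum_empty, sub_zero]
            rw [if_pos (by linarith)]
            refine ENNReal.ofReal_le_ofReal ?_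
            have h1 : Real.exp (-Y 0 ω ^ 2 / (2 * (b + 2 * a ^ 2))) ≤ 1 := by
              rw [Real.exp_le_one_iff]
              apply div_nonpos_of_nonpos_of_nonneg
              · nlinarith [sq_nonneg (Y 0 ω)]
              · positivity
            have h2 : 1 / Real.sqrt (b + 2 * a ^ 2) ≤ 1 / Real.sqrt b := by
              apply one_div_le_one_div_of_le (Real.sqrt_pos.2 hb)
              exact Real.sqrt_le_sqrt (by linarith)
            calc _ ≤ 1 / Real.sqrt (b + 2 * a ^ 2) * 1 := by gcongr
              _ ≤ _ := by rw [mul_one]; exact h2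
        _ = _ := by simp
    | succ t ih =>
      intro ht
      have e := h.step ht (fun ω => (Y t ω, Q t ω, v (t + 1) ω))
        ((hYm t (by omega)).prodMk ((hQm t (by omega)).prodMk (h.vmeas' (by omega) le_rfl ht)))
        (fun p => H (p.1.1 + p.1.2.2 * p.2, p.1.2.1 - p.1.2.2 ^ 2)) (hHm.comp (by fun_prop))
      calc ∫⁻ ω, H (Y (t + 1) ω, Q (t + 1) ω) ∂μ
          = ∫⁻ ω, H (Y t ω + v (t + 1) ω * ε (t + 1) ω, Q t ω - v (t + 1) ω ^ 2) ∂μ := by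
            refine lintegral_congr fun ω => ?_
            simp only [hY, hQ, Finset.sum_Icc_succ_top (Nat.le_add_left 1 t)]
            congr 2 <;> ring
        _ = _ := e
        _ ≤ ∫⁻ ω, H (Y t ω, Q t ω) ∂μ := lintegral_mono fun ω => hstep _ _ _
        _ ≤ _ := ih (by omega)
  have hfin := hdec N le_rfl
  set κ : ℝ := 1 / (3 * a) with hκ
  have hκ0 : 0 < κ := by positivity
  have hmeas : AEMeasurable (fun ω => H (Y N ω, Q N ω)) μ :=
    (hHm.comp (((hYm N le_rfl).mono (h.le N) le_rfl).prodMk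
      ((hQm N le_rfl).mono (h.le N) le_rfl))).aemeasurable
  have hsub : {ω | |Y0 ω + ∑ i ∈ Finset.Icc 1 N, v i ω * ε i ω| ≤ a ∧
      |∑ i ∈ Finset.Icc 1 N, v i ω ^ 2 - b| ≤ a ^ 2} ⊆
      {ω | ENNReal.ofReal κ ≤ H (Y N ω, Q N ω)} := by
    rintro ω ⟨h1, h2⟩
    have h1' : |Y N ω| ≤ a := h1
    have hq1 : a ^ 2 ≤ Q N ω := by
      have := (abs_le.1 h2).2
      simp only [hQ]; linarith
    have hq2 : Q N ω ≤ 3 * a ^ 2 := by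
      have := (abs_le.1 h2).1
      simp only [hQ]; linarith
    have hq0 : 0 < Q N ω := lt_of_lt_of_le ha2 hq1
    simp only [Set.mem_setOf_eq, hH]
    rw [if_pos hq1]
    refine ENNReal.ofReal_le_ofReal ?_
    have hYsq : Y N ω ^ 2 ≤ a ^ 2 := by
      rw [← sq_abs]; gcongr
    have hexp : Real.exp (-(1 / 2)) ≤ Real.exp (-Y N ω ^ 2 / (2 * Q N ω)) := by
      rw [Real.exp_le_exp, neg_div, neg_le_neg_iff, div_le_iff₀ (by positivity)]
      linarith
    have hsq : Real.sqrt (Q N ω) ≤ Real.sqrt 3 * a := by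
      rw [Real.sqrt_le_left (by positivity), mul_pow, Real.sq_sqrt (by norm_num)]
      exact hq2
    have he : Real.exp (1 / 2) * Real.sqrt 3 ≤ 3 := by
      have e1 : Real.exp (1 / 2) ^ 2 ≤ 3 := by
        rw [← Real.exp_nat_mul]; norm_num
        linarith [Real.exp_one_lt_d9]
      have e2 : Real.sqrt 3 ^ 2 = 3 := Real.sq_sqrt (by norm_num)
      have : (Real.exp (1 / 2) * Real.sqrt 3) ^ 2 ≤ 3 ^ 2 := by
        rw [mul_pow, e2]; linarith
      exact le_of_sq_le_sq this (by norm_num)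
    calc κ ≤ 1 / (Real.sqrt 3 * a) * Real.exp (-(1 / 2)) := by
          rw [hκ, Real.exp_neg, ← one_div, div_mul_div_comm, one_mul]
          apply one_div_le_one_div_of_le (by positivity)
          calc Real.sqrt 3 * a * Real.exp (1 / 2) = (Real.exp (1 / 2) * Real.sqrt 3) * a := by ring
            _ ≤ 3 * a := by gcongr
      _ ≤ _ := by gcongr
  calc _ ≤ μ {ω | ENNReal.ofReal κ ≤ H (Y N ω, Q N ω)} := measure_mono hsub
    _ ≤ (∫⁻ ω, H (Y N ω, Q N ω) ∂μ) / ENNReal.ofReal κ :=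
        meas_ge_le_lintegral_div hmeas (by simpa using hκ0) ENNReal.ofReal_ne_top
    _ ≤ ENNReal.ofReal (1 / Real.sqrt b) / ENNReal.ofReal κ := by gcongr
    _ = _ := by
        rw [← ENNReal.ofReal_div_of_pos hκ0]
        congr 1
        rw [hκ]; field_simp

theorem lower (h : GS μ ℱ N v ε) [IsProbabilityMeasure μ] (κ ρ θ : ℝ) (hθ : 0 < θ) (hρ : 0 < ρ) :
    μ {ω | ∑ i ∈ Finset.Icc 1 N, (v i ω * ε i ω) ^ 2 ≤ κ ∧
      ρ ≤ ∑ i ∈ Finset.Icc 1 N, v i ω ^ 2} ≤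
        ENNReal.ofReal (Real.exp (θ * κ) / Real.sqrt (1 + 2 * θ * ρ)) := by
  set C : ℕ → Ω → ℝ := fun t ω => Real.exp (-θ * ∑ i ∈ Finset.Icc 1 t, (v i ω * ε i ω) ^ 2) *
    Real.sqrt (∏ i ∈ Finset.Icc 1 t, (1 + 2 * θ * v i ω ^ 2)) with hC
  have hC0 : ∀ t ω, 0 ≤ C t ω := fun t ω => by positivity
  have hCm : ∀ t, t ≤ N → Measurable[ℱ t] (C t) := by
    intro t ht
    refine Measurable.mul ?_ ?_
    · exact Real.measurable_exp.comp ((h.usqsummeas le_rfl ht).const_mul _)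
    · refine Measurable.sqrt (Finset.measurable_fun_prod _ fun i hi => ?_)
      rw [Finset.mem_Icc] at hi
      exact (((h.vmeas' hi.1 (by omega) (by omega)).pow_const 2).const_mul _).const_add _
  have hdec : ∀ t, t ≤ N → ∫⁻ ω, ENNReal.ofReal (C t ω) ∂μ = 1 := by
    intro t
    induction t with
    | zero => intro _; simp [hC]
    | succ t ih =>
      intro ht
      have e := h.step ht (fun ω => (C t ω, v (t + 1) ω))
        ((hCm t (by omega)).prodMk (h.vmeas' (by omega) le_rfl ht))
        (fun p => ENNReal.ofReal p.1.1 * ENNReal.ofReal (Real.sqrt (1 + 2 * θ * p.1.2 ^ 2)) *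
          ENNReal.ofReal (Real.exp (-(0 + p.1.2 * p.2) ^ 2 / (2 * (1 / (2 * θ)))))) (by fun_prop)
      rw [← ih (by omega)]
      calc ∫⁻ ω, ENNReal.ofReal (C (t + 1) ω) ∂μ
          = ∫⁻ ω, ENNReal.ofReal (C t ω) * ENNReal.ofReal (Real.sqrt (1 + 2 * θ * v (t + 1) ω ^ 2)) *
          ENNReal.ofReal (Real.exp (-(0 + v (t + 1) ω * ε (t + 1) ω) ^ 2 / (2 * (1 / (2 * θ))))) ∂μ := by
            refine lintegral_congr fun ω => ?_
            rw [← ENNReal.ofReal_mul (hC0 _ _), ← ENNReal.ofReal_mul (mul_nonneg (hC0 _ _) (Real.sqrt_nonneg _))]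
            congr 1
            simp only [hC, Finset.sum_Icc_succ_top (Nat.le_add_left 1 t),
              Finset.prod_Icc_succ_top (Nat.le_add_left 1 t)]
            rw [Real.sqrt_mul (Finset.prod_nonneg fun i _ => by positivity), mul_add, Real.exp_add]
            have : -(0 + v (t + 1) ω * ε (t + 1) ω) ^ 2 / (2 * (1 / (2 * θ))) =
              -θ * (v (t + 1) ω * ε (t + 1) ω) ^ 2 := by field_simp; ring
            rw [this]; ring
        _ = _ := e
        _ = ∫⁻ ω, ENNReal.ofReal (C t ω) ∂μ := by
            refine lintegral_congr fun ω => ?_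
            dsimp only
            rw [lintegral_const_mul _ (by fun_prop), gauss_exp _ _ _ (by positivity), mul_assoc,
              ← ENNReal.ofReal_mul (by positivity)]
            have : Real.sqrt (1 + 2 * θ * v (t + 1) ω ^ 2) *
                (Real.sqrt (1 / (2 * θ) / (1 / (2 * θ) + v (t + 1) ω ^ 2)) *
                Real.exp (-0 ^ 2 / (2 * (1 / (2 * θ) + v (t + 1) ω ^ 2)))) = 1 := by
              have e0 : (-0 ^ 2 / (2 * (1 / (2 * θ) + v (t + 1) ω ^ 2)) : ℝ) = 0 := by simp
              rw [e0, Real.exp_zero, mul_one, ← Real.sqrt_mul (by positivity), Real.sqrt_eq_one]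
              field_simp
            rw [this]; simp
  have hfin := hdec N le_rfl
  set δ : ℝ := Real.exp (-(θ * κ)) * Real.sqrt (1 + 2 * θ * ρ) with hδ
  have hδ0 : 0 < δ := by positivity
  have hmeas : AEMeasurable (fun ω => ENNReal.ofReal (C N ω)) μ :=
    ((hCm N le_rfl).mono (h.le N) le_rfl).ennreal_ofReal.aemeasurable
  calc _ ≤ μ {ω | ENNReal.ofReal δ ≤ ENNReal.ofReal (C N ω)} := by
        refine measure_mono ?_
        rintro ω ⟨h1, h2⟩
        refine ENNReal.ofReal_le_ofReal ?_
        simp only [hδ, hC]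
        gcongr
        · nlinarith
        · calc 1 + 2 * θ * ρ ≤ 1 + ∑ i ∈ Finset.Icc 1 N, 2 * θ * v i ω ^ 2 := by
                rw [← Finset.mul_sum]; gcongr
            _ ≤ _ := prod_ge_one_add_sum _ _ fun i => by positivity
    _ ≤ (∫⁻ ω, ENNReal.ofReal (C N ω) ∂μ) / ENNReal.ofReal δ :=
        meas_ge_le_lintegral_div hmeas (by simpa using hδ0) ENNReal.ofReal_ne_top
    _ = _ := by
        rw [hfin, ← ENNReal.ofReal_one, ← ENNReal.ofReal_div_of_pos hδ0]
        congr 1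
        rw [hδ, Real.exp_neg]; field_simp

theorem maxineq (h : GS μ ℱ N v ε) [IsProbabilityMeasure μ] (K : ℝ) (hK : 0 < K) :
    μ {ω | ∃ t ≤ N, K ≤ |∑ i ∈ Finset.Icc 1 t, v i ω * ε i ω|} ≤
      (∑ i ∈ Finset.Icc 1 N, ∫⁻ ω, ENNReal.ofReal (v i ω ^ 2) ∂μ) / ENNReal.ofReal (K ^ 2) := by
  classical
  set Z : ℕ → Ω → ℝ := fun t ω => ∑ i ∈ Finset.Icc 1 t, v i ω * ε i ω with hZ
  set F : ℕ → Set Ω := fun t => {ω | ∃ s ≤ t, K ≤ |Z s ω|} with hF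
  have hFm : ∀ t, t ≤ N → MeasurableSet[ℱ t] (F t) := by
    intro t ht
    have : F t = ⋃ s ∈ Finset.range (t + 1), {ω | K ≤ |Z s ω|} := by
      ext ω; simp [hF, Nat.lt_succ_iff]
    rw [this]
    refine Finset.measurableSet_biUnion _ fun s hs => ?_
    have hs' : s ≤ t := by simpa [Nat.lt_succ_iff] using hs
    have hZs : Measurable[ℱ t] (Z s) := h.summeas hs' (by omega)
    have : Measurable[ℱ t] (fun ω => |Z s ω|) := measurable_norm.comp hZs
    exact this measurableSet_Ici
  set f : ℕ → Ω → ENNReal := fun t ω => ENNReal.ofReal (if ω ∈ F t then K ^ 2 else Z t ω ^ 2) with hf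
  have hfm : ∀ t, t ≤ N → Measurable[ℱ t] (f t) := fun t ht =>
    (Measurable.ite (hFm t ht) measurable_const
      ((h.summeas le_rfl ht).pow_const 2)).ennreal_ofReal
  have hdec : ∀ t, t ≤ N → ∫⁻ ω, f t ω ∂μ ≤
      ∑ i ∈ Finset.Icc 1 t, ∫⁻ ω, ENNReal.ofReal (v i ω ^ 2) ∂μ := by
    intro t
    induction t with
    | zero =>
      intro _
      have : ∀ ω, f 0 ω = 0 := by
        intro ω
        have : ω ∉ F 0 := by
          simp [hF, hZ, hK]
        simp [hf, this, hZ]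
      simp [this]
    | succ t ih =>
      intro ht
      set I : Ω → ℝ := fun ω => if ω ∈ F t then 1 else 0 with hI
      have hIm : Measurable[ℱ t] I := Measurable.ite (hFm t (by omega)) measurable_const measurable_const
      have e := h.step ht (fun ω => (I ω, Z t ω, v (t + 1) ω))
        (hIm.prodMk ((h.summeas le_rfl (by omega)).prodMk (h.vmeas' (by omega) le_rfl ht)))
        (fun p => if p.1.1 = 1 then ENNReal.ofReal (K ^ 2) else
          ENNReal.ofReal ((p.1.2.1 + p.1.2.2 * p.2) ^ 2))
        (Measurable.ite ((measurable_fst.comp measurable_fst) (measurableSet_singleton 1))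
          measurable_const (by fun_prop))
      rw [Finset.sum_Icc_succ_top (Nat.le_add_left 1 t)]
      calc ∫⁻ ω, f (t + 1) ω ∂μ ≤ ∫⁻ ω, (if I ω = 1 then ENNReal.ofReal (K ^ 2) else
          ENNReal.ofReal ((Z t ω + v (t + 1) ω * ε (t + 1) ω) ^ 2)) ∂μ := by
            refine lintegral_mono fun ω => ?_
            have hZs : Z (t + 1) ω = Z t ω + v (t + 1) ω * ε (t + 1) ω := by
              simp only [hZ, Finset.sum_Icc_succ_top (Nat.le_add_left 1 t)]
            by_cases hw : ω ∈ F t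
            · have hw' : ω ∈ F (t + 1) := by
                obtain ⟨s, hs, hs'⟩ := hw; exact ⟨s, by omega, hs'⟩
              simp [hf, hI, hw, hw']
            · have hIw : I ω = 0 := by simp [hI, hw]
              rw [hIw, if_neg (by norm_num), ← hZs]
              simp only [hf]
              refine ENNReal.ofReal_le_ofReal ?_
              split_ifs with hw'
              · obtain ⟨s, hs, hs'⟩ := hw'
                have : s = t + 1 := by
                  by_contra hne
                  exact hw ⟨s, by omega, hs'⟩
                subst this
                rw [← sq_abs (Z _ _)]; gcongr
              · exact le_rfl
        _ = _ := e
        _ ≤ ∫⁻ ω, (f t ω + ENNReal.ofReal (v (t + 1) ω ^ 2)) ∂μ := by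
            refine lintegral_mono fun ω => ?_
            dsimp only
            by_cases hw : ω ∈ F t
            · simp [hI, hw, hf]
            · have hIw : I ω = 0 := by simp [hI, hw]
              simp only [hIw, zero_ne_one, if_false]
              rw [gauss_sq, ENNReal.ofReal_add (by positivity) (by positivity)]
              simp [hf, hw]
        _ ≤ _ := by
            rw [lintegral_add_left ((hfm t (by omega)).mono (h.le t) le_rfl)]
            gcongr
            exact ih (by omega)
  calc _ ≤ μ {ω | ENNReal.ofReal (K ^ 2) ≤ f N ω} := by
        refine measure_mono fun ω hω => ?_
        have : ω ∈ F N := hω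
        simp [hf, this]
    _ ≤ (∫⁻ ω, f N ω ∂μ) / ENNReal.ofReal (K ^ 2) :=
        meas_ge_le_lintegral_div ((hfm N le_rfl).mono (h.le N) le_rfl).aemeasurable
          (by simpa using hK.ne') ENNReal.ofReal_ne_top
    _ ≤ _ := by gcongr; exact hdec N le_rfl

theorem usq (h : GS μ ℱ N v ε) [IsProbabilityMeasure μ] (K : ℝ) (hK : 0 < K) :
    μ {ω | K ≤ ∑ i ∈ Finset.Icc 1 N, (v i ω * ε i ω) ^ 2} ≤
      (∑ i ∈ Finset.Icc 1 N, ∫⁻ ω, ENNReal.ofReal (v i ω ^ 2) ∂μ) / ENNReal.ofReal K := by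
  have hm : ∀ i ∈ Finset.Icc 1 N, Measurable (fun ω => ENNReal.ofReal ((v i ω * ε i ω) ^ 2)) := by
    intro i hi
    rw [Finset.mem_Icc] at hi
    exact (((h.adapted i hi.1 hi.2).mono (h.le i) le_rfl).pow_const 2).ennreal_ofReal
  have hE : ∫⁻ ω, ENNReal.ofReal (∑ i ∈ Finset.Icc 1 N, (v i ω * ε i ω) ^ 2) ∂μ =
      ∑ i ∈ Finset.Icc 1 N, ∫⁻ ω, ENNReal.ofReal (v i ω ^ 2) ∂μ := by
    simp_rw [ENNReal.ofReal_sum_of_nonneg (fun i (_ : i ∈ Finset.Icc 1 N) => sq_nonneg _)]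
    rw [lintegral_finsetSum _ hm]
    refine Finset.sum_congr rfl fun i hi => ?_
    rw [Finset.mem_Icc] at hi
    obtain ⟨t, rfl⟩ : ∃ t, i = t + 1 := ⟨i - 1, by omega⟩
    have e := h.step hi.2 (fun ω => v (t + 1) ω) (h.vmeas' (by omega) le_rfl hi.2)
      (fun p => ENNReal.ofReal ((0 + p.1 * p.2) ^ 2)) (by fun_prop)
    simp only [gauss_sq] at e
    simpa using e
  rw [← hE]
  calc _ ≤ μ {ω | ENNReal.ofReal K ≤ ENNReal.ofReal (∑ i ∈ Finset.Icc 1 N, (v i ω * ε i ω) ^ 2)} :=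
        measure_mono fun ω hω => ENNReal.ofReal_le_ofReal hω
    _ ≤ _ := meas_ge_le_lintegral_div
        ((h.usqsummeas le_rfl le_rfl).mono (h.le N) le_rfl).ennreal_ofReal.aemeasurable
          (by simpa using hK) ENNReal.ofReal_ne_top

theorem hit (h : GS μ ℱ N v ε) [IsProbabilityMeasure μ] {t : ℕ} (ht : t + 1 ≤ N) (W : Ω → ℝ)
    (hW : Measurable[ℱ t] W) : μ {ω | ε (t + 1) ω = W ω} = 0 := by
  classical
  have hms : MeasurableSet {p : ℝ × ℝ | p.2 = p.1} := measurableSet_eq_fun measurable_snd measurable_fst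
  have e := h.step ht W hW ({p : ℝ × ℝ | p.2 = p.1}.indicator 1) (measurable_one.indicator hms)
  have e1 : ∫⁻ ω, ({p : ℝ × ℝ | p.2 = p.1}.indicator 1 : ℝ × ℝ → ENNReal) (W ω, ε (t + 1) ω) ∂μ =
      μ {ω | ε (t + 1) ω = W ω} := by
    rw [← lintegral_indicator_one]
    · rfl
    · exact measurableSet_eq_fun (h.emeas _) (hW.mono (h.le t) le_rfl)
  rw [← e1, e]
  have := nullSingletonClass_gaussianReal (μ := 0) (v := 1) one_ne_zero
  have : ∀ w : ℝ, ∫⁻ x, ({p : ℝ × ℝ | p.2 = p.1}.indicator 1 : ℝ × ℝ → ENNReal) (w, x)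
      ∂(gaussianReal 0 1) = 0 := by
    intro w
    have : (fun x => ({p : ℝ × ℝ | p.2 = p.1}.indicator 1 : ℝ × ℝ → ENNReal) (w, x)) =
        ({w} : Set ℝ).indicator 1 := by
      funext x
      simp [Set.indicator]
    rw [this, lintegral_indicator_one (measurableSet_singleton w), measure_singleton]
  simp [this]

theorem null (h : GS μ ℱ N v ε) [IsProbabilityMeasure μ] (hN : 3 ≤ N)
    (hpos : ∀ t, 1 ≤ t → t ≤ N → ∀ ω, 0 < v t ω) :
    μ {ω | (v 3 ω * ε 3 ω) * (v 1 ω * ε 1 ω) = (v 2 ω * ε 2 ω) ^ 2} = 0 := by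
  have h1 := h.hit (t := 0) (by omega) (fun _ => 0) measurable_const
  have h3 := h.hit (t := 2) (by omega)
    (fun ω => (v 2 ω * ε 2 ω) ^ 2 / (v 3 ω * (v 1 ω * ε 1 ω)))
    (((h.umeas' (by omega) (by omega) (by omega)).pow_const 2).div
      ((h.vmeas' (by omega) (by omega) (by omega)).mul (h.umeas' (by omega) (by omega) (by omega))))
  refine measure_mono_null ?_ (measure_union_null h1 h3)
  intro ω hω
  by_cases h0 : ε 1 ω = 0
  · exact Or.inl h0
  · right
    have p1 := (hpos 1 le_rfl (by omega) ω).ne'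
    have p3 := (hpos 3 (by omega) hN ω).ne'
    simp only [Set.mem_setOf_eq] at hω ⊢
    norm_num
    rw [eq_div_iff (by positivity), ← hω]
    ring

end GS

section paths

variable {Ω : Type*} (X : ℕ → Ω → ℝ) (τ : ℕ) (ω : Ω)

/-- demeaned sum of squares -/
noncomputable def SS : ℝ := ∑ j ∈ Finset.Icc 1 τ, (xtil X τ (j - 1) ω) ^ 2
/-- score -/
noncomputable def AA : ℝ := ∑ j ∈ Finset.Icc 1 τ, xtil X τ (j - 1) ω * (X j ω - X (j - 1) ω)
/-- sum of squared increments -/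
noncomputable def DD : ℝ := ∑ j ∈ Finset.Icc 1 τ, (X j ω - X (j - 1) ω) ^ 2

theorem SS_nonneg : 0 ≤ SS X τ ω := Finset.sum_nonneg fun _ _ => sq_nonneg _

theorem xbar_mul (hτ : 1 ≤ τ) : xbar X τ ω * τ = ∑ k ∈ Finset.Icc 1 τ, X (k - 1) ω := by
  have : (τ : ℝ) ≠ 0 := by positivity
  rw [xbar, div_mul_cancel₀ _ this]

theorem xtil_sum (hτ : 1 ≤ τ) : ∑ j ∈ Finset.Icc 1 τ, xtil X τ (j - 1) ω = 0 := by
  simp only [xtil, Finset.sum_sub_distrib, Finset.sum_const, Nat.card_Icc, nsmul_eq_mul]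
  rw [← xbar_mul X τ ω hτ]
  simp; ring

theorem delta_num (hτ : 1 ≤ τ) : ∑ j ∈ Finset.Icc 1 τ, xtil X τ (j - 1) ω * X j ω =
    AA X τ ω + SS X τ ω := by
  have h0 : xbar X τ ω * ∑ j ∈ Finset.Icc 1 τ, xtil X τ (j - 1) ω = 0 := by
    rw [xtil_sum X τ ω hτ, mul_zero]
  rw [← add_zero (AA X τ ω + SS X τ ω), ← h0, AA, SS, Finset.mul_sum, ← Finset.sum_add_distrib,
    ← Finset.sum_add_distrib]
  refine Finset.sum_congr rfl fun j _ => ?_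
  simp only [xtil]; ring

theorem delta_eq (hτ : 1 ≤ τ) (hS : SS X τ ω ≠ 0) :
    deltaHat X τ ω - 1 = AA X τ ω / SS X τ ω := by
  rw [deltaHat, delta_num X τ ω hτ]
  change (AA X τ ω + SS X τ ω) / SS X τ ω - 1 = _
  field_simp; ring

theorem quad (f : ℝ) : ∑ j ∈ Finset.Icc 1 τ,
    ((X j ω - X (j - 1) ω) - f * xtil X τ (j - 1) ω) ^ 2 =
      DD X τ ω - 2 * f * AA X τ ω + f ^ 2 * SS X τ ω := by
  rw [DD, AA, SS, Finset.mul_sum, Finset.mul_sum, ← Finset.sum_sub_distrib, ← Finset.sum_add_distrib]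
  refine Finset.sum_congr rfl fun j _ => ?_
  ring

theorem sigma_eq0 (hτ : 1 ≤ τ) : sigmaHatSq X τ ω * τ = ∑ j ∈ Finset.Icc 1 τ,
    ((X j ω - X (j - 1) ω) - (deltaHat X τ ω - 1) * xtil X τ (j - 1) ω) ^ 2 := by
  have : (τ : ℝ) ≠ 0 := by positivity
  rw [sigmaHatSq, div_mul_cancel₀ _ this]
  refine Finset.sum_congr rfl fun j _ => ?_
  simp only [xtil]; ring

theorem sigma_eq (hτ : 1 ≤ τ) (hS : SS X τ ω ≠ 0) :
    sigmaHatSq X τ ω * τ = DD X τ ω - AA X τ ω ^ 2 / SS X τ ω := by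
  rw [sigma_eq0 X τ ω hτ, quad, delta_eq X τ ω hτ hS]
  field_simp; ring

theorem sigma_le (hτ : 1 ≤ τ) (hS : 0 < SS X τ ω) (f : ℝ) :
    sigmaHatSq X τ ω * τ ≤ ∑ j ∈ Finset.Icc 1 τ,
    ((X j ω - X (j - 1) ω) - f * xtil X τ (j - 1) ω) ^ 2 := by
  rw [sigma_eq X τ ω hτ hS.ne', quad]
  have : 0 ≤ (f * SS X τ ω - AA X τ ω) ^ 2 / SS X τ ω := by positivity
  have e : (f * SS X τ ω - AA X τ ω) ^ 2 / SS X τ ω = f ^ 2 * SS X τ ω - 2 * f * AA X τ ω +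
      AA X τ ω ^ 2 / SS X τ ω := by field_simp; ring
  linarith

theorem T_eq (hτ : 1 ≤ τ) (hS : 0 < SS X τ ω) (hq : 0 < sigmaHatSq X τ ω) :
    svadfT X τ ω = AA X τ ω / Real.sqrt (SS X τ ω * sigmaHatSq X τ ω) := by
  have h1 : svadfT X τ ω = Real.sqrt (SS X τ ω / sigmaHatSq X τ ω) * (deltaHat X τ ω - 1) := rfl
  rw [h1, delta_eq X τ ω hτ hS.ne', Real.sqrt_div hS.le, Real.sqrt_mul hS.le]
  have a1 : Real.sqrt (SS X τ ω) ≠ 0 := (Real.sqrt_pos.2 hS).ne'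
  have a2 : Real.sqrt (sigmaHatSq X τ ω) ≠ 0 := (Real.sqrt_pos.2 hq).ne'
  have a3 := hS.ne'
  have a4 : Real.sqrt (SS X τ ω) ^ 2 = SS X τ ω := Real.sq_sqrt hS.le
  rw [div_mul_div_comm, div_eq_div_iff (mul_ne_zero a2 a3) (mul_ne_zero a1 a2)]
  nth_rewrite 3 [← a4]
  ring

theorem AA_eq : 2 * AA X τ ω = X τ ω ^ 2 - X 0 ω ^ 2 - DD X τ ω
    - 2 * xbar X τ ω * (X τ ω - X 0 ω) := by
  have key : ∀ (b : ℝ) (t : ℕ), 2 * ∑ j ∈ Finset.Icc 1 t, (X (j - 1) ω - b) * (X j ω - X (j - 1) ω) =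
      X t ω ^ 2 - X 0 ω ^ 2 - ∑ j ∈ Finset.Icc 1 t, (X j ω - X (j - 1) ω) ^ 2
        - 2 * b * (X t ω - X 0 ω) := by
    intro b t
    induction t with
    | zero => simp
    | succ t ih =>
      rw [Finset.sum_Icc_succ_top (Nat.le_add_left 1 t), Finset.sum_Icc_succ_top (Nat.le_add_left 1 t),
        mul_add, ih, Nat.add_sub_cancel]
      ring
  exact key _ _

theorem SS_le (hτ : 1 ≤ τ) : SS X τ ω ≤ ∑ j ∈ Finset.Icc 1 τ, X (j - 1) ω ^ 2 := by
  have h0 := xtil_sum X τ ω hτ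
  have : ∑ j ∈ Finset.Icc 1 τ, X (j - 1) ω ^ 2 = SS X τ ω +
      2 * xbar X τ ω * ∑ j ∈ Finset.Icc 1 τ, xtil X τ (j - 1) ω + τ * xbar X τ ω ^ 2 := by
    have hc : (τ : ℝ) * xbar X τ ω ^ 2 = ∑ j ∈ Finset.Icc 1 τ, xbar X τ ω ^ 2 := by simp
    rw [SS, hc, Finset.mul_sum, ← Finset.sum_add_distrib, ← Finset.sum_add_distrib]
    refine Finset.sum_congr rfl fun j _ => ?_
    simp only [xtil]; ring
  rw [this, h0]
  nlinarith [mul_nonneg (Nat.cast_nonneg τ : (0 : ℝ) ≤ τ) (sq_nonneg (xbar X τ ω))]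

theorem xbar_abs (hτ : 1 ≤ τ) (B : ℝ) (hB : ∑ j ∈ Finset.Icc 1 τ, |X (j - 1) ω| ≤ B) :
    |xbar X τ ω| ≤ B / τ := by
  have hp : (0 : ℝ) < τ := by positivity
  rw [xbar, abs_div, abs_of_pos hp]
  gcongr
  exact (Finset.abs_sum_le_sum_abs _ _).trans hB

/-- upper bound for the statistic in the pre-bubble regime -/
theorem T_upper (hτ : 1 ≤ τ) (n : ℕ) (hn : τ ≤ n) (K κ s : ℝ) (hκ : 0 < κ) (hs : 0 < s)
    (hX : ∀ j ≤ τ, |X j ω| ≤ K * s) (hS : κ * n * s ^ 2 ≤ SS X τ ω) (hD : κ * s ^ 2 ≤ DD X τ ω)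
    (hnl : 18 * K ^ 4 ≤ κ ^ 2 * n) : svadfT X τ ω ≤ 5 * K ^ 2 / κ := by
  have hn0 : (0 : ℝ) < n := by exact_mod_cast (by omega : 0 < n)
  have hτ0 : (0 : ℝ) < τ := by exact_mod_cast (by omega : 0 < τ)
  have hτn : (τ : ℝ) ≤ n := by exact_mod_cast hn
  have hK0 : 0 ≤ K := by
    have := (abs_nonneg _).trans (hX 0 (Nat.zero_le _))
    by_contra hneg
    push Not at hneg
    nlinarith
  have hSp : 0 < SS X τ ω := lt_of_lt_of_le (by positivity) hS
  by_cases hA : AA X τ ω ≤ 0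
  · have h1 : svadfT X τ ω = Real.sqrt (SS X τ ω / sigmaHatSq X τ ω) * (deltaHat X τ ω - 1) := rfl
    rw [h1, delta_eq X τ ω hτ hSp.ne']
    have : AA X τ ω / SS X τ ω ≤ 0 := div_nonpos_of_nonpos_of_nonneg hA hSp.le
    have h2 : 0 ≤ 5 * K ^ 2 / κ := by positivity
    have h3 := Real.sqrt_nonneg (SS X τ ω / sigmaHatSq X τ ω)
    nlinarith
  push Not at hA
  have hxb : |xbar X τ ω| ≤ K * s := by
    have := xbar_abs X τ ω hτ (τ * (K * s)) (by
      calc ∑ j ∈ Finset.Icc 1 τ, |X (j - 1) ω| ≤ ∑ j ∈ Finset.Icc 1 τ, K * s := by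
            refine Finset.sum_le_sum fun j hj => hX _ ?_
            rw [Finset.mem_Icc] at hj; omega
        _ = _ := by simp)
    rwa [mul_div_cancel_left₀ _ hτ0.ne'] at this
  have hAle : AA X τ ω ≤ 3 * K ^ 2 * s ^ 2 := by
    have e := AA_eq X τ ω
    have hD0 : 0 ≤ DD X τ ω := le_trans (by positivity) hD
    have x1 := hX τ le_rfl
    have x0 := hX 0 (Nat.zero_le _)
    have p1 : X τ ω ^ 2 ≤ (K * s) ^ 2 := by rw [← sq_abs]; gcongr
    have p2 : |xbar X τ ω * (X τ ω - X 0 ω)| ≤ (K * s) * (K * s + K * s) := by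
      rw [abs_mul]
      gcongr
      exact (abs_sub _ _).trans (add_le_add x1 x0)
    have p3 := neg_abs_le (xbar X τ ω * (X τ ω - X 0 ω))
    nlinarith [sq_nonneg (X 0 ω)]
  have hAsq : AA X τ ω ^ 2 ≤ (3 * K ^ 2 * s ^ 2) ^ 2 := by gcongr
  have hR : κ * s ^ 2 / 2 ≤ sigmaHatSq X τ ω * τ := by
    rw [sigma_eq X τ ω hτ hSp.ne']
    have : AA X τ ω ^ 2 / SS X τ ω ≤ κ * s ^ 2 / 2 := by
      rw [div_le_iff₀ hSp]
      calc AA X τ ω ^ 2 ≤ (3 * K ^ 2 * s ^ 2) ^ 2 := hAsq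
        _ = (18 * K ^ 4) * s ^ 4 / 2 := by ring
        _ ≤ (κ ^ 2 * n) * s ^ 4 / 2 := by gcongr
        _ = κ * s ^ 2 / 2 * (κ * n * s ^ 2) := by ring
        _ ≤ _ := by gcongr
    linarith
  have hq : 0 < sigmaHatSq X τ ω := by
    by_contra hneg
    push Not at hneg
    have : sigmaHatSq X τ ω * τ ≤ 0 := mul_nonpos_of_nonpos_of_nonneg hneg hτ0.le
    have : 0 < κ * s ^ 2 / 2 := by positivity
    linarith
  have hqn : κ * s ^ 2 / 2 ≤ sigmaHatSq X τ ω * n := hR.trans (by gcongr)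
  rw [T_eq X τ ω hτ hSp hq, div_le_iff₀ (Real.sqrt_pos.2 (by positivity))]
  have hprod : κ ^ 2 * s ^ 4 / 2 ≤ SS X τ ω * sigmaHatSq X τ ω := by
    calc κ ^ 2 * s ^ 4 / 2 = (κ * s ^ 2) * (κ * s ^ 2 / 2) := by ring
      _ ≤ (κ * s ^ 2) * (sigmaHatSq X τ ω * n) := by gcongr
      _ = (κ * n * s ^ 2) * sigmaHatSq X τ ω := by ring
      _ ≤ _ := by gcongr
  have hsq : κ * s ^ 2 * (3 / 5) ≤ Real.sqrt (SS X τ ω * sigmaHatSq X τ ω) := by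
    apply Real.le_sqrt_of_sq_le
    refine le_trans ?_ hprod
    have : 0 ≤ κ ^ 2 * s ^ 4 := by positivity
    nlinarith
  calc AA X τ ω ≤ 3 * K ^ 2 * s ^ 2 := hAle
    _ = 5 * K ^ 2 / κ * (κ * s ^ 2 * (3 / 5)) := by field_simp
    _ ≤ _ := by gcongr

theorem SS_lower (hτ : 1 ≤ τ) (h : ℕ) (hh : h + h ≤ τ) :
    (∑ i ∈ Finset.range h, (X (i + h) ω - X i ω) ^ 2) / 2 ≤ SS X τ ω := by
  have e : SS X τ ω = ∑ j ∈ Finset.range τ, (xtil X τ j ω) ^ 2 := by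
    have : ∀ (f : ℕ → ℝ) (t : ℕ), ∑ j ∈ Finset.Icc 1 t, f (j - 1) = ∑ j ∈ Finset.range t, f j := by
      intro f t
      induction t with
      | zero => simp
      | succ t ih =>
        rw [Finset.sum_Icc_succ_top (Nat.le_add_left 1 t), Finset.sum_range_succ, ih,
          Nat.add_sub_cancel]
    exact this (fun j => (xtil X τ j ω) ^ 2) τ
  rw [e]
  calc _ ≤ ∑ i ∈ Finset.range h, ((xtil X τ i ω) ^ 2 + (xtil X τ (h + i) ω) ^ 2) := by
        rw [Finset.sum_div]
        refine Finset.sum_le_sum fun i _ => ?_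
        simp only [xtil, add_comm i h]
        nlinarith [sq_nonneg ((X i ω - xbar X τ ω) + (X (h + i) ω - xbar X τ ω))]
    _ = ∑ j ∈ Finset.range (h + h), (xtil X τ j ω) ^ 2 := by
        rw [Finset.sum_add_distrib, Finset.sum_range_add]
    _ ≤ _ := by
        refine Finset.sum_le_sum_of_subset_of_nonneg (Finset.range_mono hh) fun _ _ _ => sq_nonneg _

end paths

theorem geom1 (φ : ℝ) (hφ : 0 < φ) (k0 t : ℕ) :
    ∑ j ∈ Finset.Icc 1 t, (1 + φ) ^ (j - 1 - k0) ≤ t + ((1 + φ) ^ (t - k0) - 1) / φ := by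
  induction t with
  | zero => simp
  | succ t ih =>
    rw [Finset.sum_Icc_succ_top (Nat.le_add_left 1 t), Nat.add_sub_cancel]
    push_cast
    by_cases h : k0 ≤ t
    · have : t + 1 - k0 = (t - k0) + 1 := by omega
      rw [this, pow_succ]
      have : ((1 + φ) ^ (t - k0) * (1 + φ) - 1) / φ = ((1 + φ) ^ (t - k0) - 1) / φ
          + (1 + φ) ^ (t - k0) := by field_simp; ring
      linarith
    · have h1 : t + 1 - k0 = 0 := by omega
      have h2 : t - k0 = 0 := by omega
      rw [h1]; rw [h2] at ih ⊢
      simp only [pow_zero] at ih ⊢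
      linarith

theorem geom2 (φ : ℝ) (hφ : 0 < φ) (k0 t : ℕ) :
    ∑ j ∈ Finset.Icc 1 t, ((1 + φ) ^ (j - 1 - k0)) ^ 2 ≤
      t + (((1 + φ) ^ (t - k0)) ^ 2 - 1) / φ := by
  induction t with
  | zero => simp
  | succ t ih =>
    rw [Finset.sum_Icc_succ_top (Nat.le_add_left 1 t), Nat.add_sub_cancel]
    push_cast
    by_cases h : k0 ≤ t
    · have : t + 1 - k0 = (t - k0) + 1 := by omega
      rw [this, pow_succ (1 + φ) (t - k0)]
      have e : (((1 + φ) ^ (t - k0) * (1 + φ)) ^ 2 - 1) / φ = (((1 + φ) ^ (t - k0)) ^ 2 - 1) / φ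
          + ((1 + φ) ^ (t - k0)) ^ 2 * (2 + φ) := by field_simp; ring
      rw [e]
      nlinarith [sq_nonneg ((1 + φ) ^ (t - k0))]
    · have h1 : t + 1 - k0 = 0 := by omega
      have h2 : t - k0 = 0 := by omega
      rw [h1]; rw [h2] at ih ⊢
      simp only [pow_zero] at ih ⊢
      linarith

section paths2

variable {Ω : Type*} (X : ℕ → Ω → ℝ) (τ : ℕ) (ω : Ω)

theorem sigma_pos (hτ : 3 ≤ τ) (u : ℕ → ℝ) (hu : ∀ j, 1 ≤ j → j ≤ 3 → X j ω = X (j - 1) ω + u j)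
    (hne : u 3 * u 1 ≠ u 2 ^ 2) : 0 < sigmaHatSq X τ ω := by
  have hτ0 : (0 : ℝ) < τ := by exact_mod_cast (by omega : 0 < τ)
  have h0 := sigma_eq0 X τ ω (by omega)
  have hnn : 0 ≤ sigmaHatSq X τ ω := by
    rw [sigmaHatSq]
    exact div_nonneg (Finset.sum_nonneg fun _ _ => sq_nonneg _) hτ0.le
  rcases hnn.eq_or_lt with hz | hz
  · exfalso
    rw [← hz, zero_mul, eq_comm, Finset.sum_eq_zero_iff_of_nonneg fun _ _ => sq_nonneg _] at h0
    set f := deltaHat X τ ω - 1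
    have e : ∀ j, 1 ≤ j → j ≤ 3 → u j = f * xtil X τ (j - 1) ω := by
      intro j h1 h2
      have := h0 j (Finset.mem_Icc.2 ⟨h1, by omega⟩)
      rw [pow_eq_zero_iff (by norm_num)] at this
      have h3 := hu j h1 h2
      linarith
    have e1 := e 1 le_rfl (by norm_num)
    have e2 := e 2 (by norm_num) (by norm_num)
    have e3 := e 3 (by norm_num) le_rfl
    have x1 := hu 1 le_rfl (by norm_num)
    have x2 := hu 2 (by norm_num) (by norm_num)
    norm_num [xtil] at e1 e2 e3 x1 x2
    apply hne
    have d2 : u 2 - u 1 = f * u 1 := by rw [e2, x1]; linear_combination -e1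
    have d3 : u 3 - u 1 = f * (u 1 + u 2) := by rw [e3, x2, x1]; linear_combination -e1
    linear_combination u 1 * d3 - (u 1 + u 2) * d2
  · exact hz

set_option maxHeartbeats 2000000 in
theorem T_lower (n k0 : ℕ) (hτ : 1 ≤ τ) (hn : τ ≤ n) (φ K a s : ℝ) (hφ : 0 < φ) (hφ1 : φ ≤ 1)
    (hK : 1 ≤ K) (ha : 0 < a) (hs : 0 < s) (Y u : ℕ → ℝ)
    (hu : ∀ t, 1 ≤ t → t ≤ τ → X t ω = (if k0 < t then 1 + φ else 1) * X (t - 1) ω + u t)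
    (hY : ∀ t ≤ τ, X t ω = (1 + φ) ^ (t - k0) * Y t)
    (hYK : ∀ t ≤ τ, |Y t| ≤ K * s) (hYa : a * s ≤ |Y τ|)
    (hus : ∑ j ∈ Finset.Icc 1 τ, u j ^ 2 ≤ K * s ^ 2)
    (hq : 0 < sigmaHatSq X τ ω) (hD : 3 * (n : ℝ) ≤ (1 + φ) ^ (τ - k0))
    (hc : 2 * K ^ 2 / n + 2 * φ * K ^ 2 + 4 * K ^ 2 / (φ * τ) ≤ a ^ 2 / 4) :
    a ^ 2 / (24 * K ^ 2) * (Real.sqrt φ * τ) ≤ svadfT X τ ω := by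
  have hτ0 : (0 : ℝ) < τ := by exact_mod_cast (by omega : 0 < τ)
  have hn1 : (1 : ℝ) ≤ n := by exact_mod_cast (by omega : 1 ≤ n)
  have hn0 : (0 : ℝ) < n := by linarith
  have hτn : (τ : ℝ) ≤ n := by exact_mod_cast hn
  have hK0 : 0 < K := by linarith
  set D : ℝ := (1 + φ) ^ (τ - k0) with hDdef
  have hD1 : 1 ≤ D := by linarith
  have hD0 : 0 < D := by linarith
  have hDD2 : D ≤ D ^ 2 := by nlinarith
  have hnD2 : (n : ℝ) ≤ D ^ 2 := by linarith
  have hDφ : D ≤ D / φ := by rw [le_div_iff₀ hφ]; nlinarith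
  have hD2φ : D ^ 2 ≤ D ^ 2 / φ := by rw [le_div_iff₀ hφ]; nlinarith [sq_nonneg D]
  -- absolute sums
  have hXabs : ∀ j ∈ Finset.Icc 1 τ, |X (j - 1) ω| ≤ K * s * (1 + φ) ^ (j - 1 - k0) := by
    intro j hj
    rw [Finset.mem_Icc] at hj
    rw [hY (j - 1) (by omega), abs_mul, abs_of_pos (by positivity), mul_comm]
    gcongr
    exact hYK _ (by omega)
  have hsum1 : ∑ j ∈ Finset.Icc 1 τ, |X (j - 1) ω| ≤ 2 * K * s * D / φ := by
    calc _ ≤ ∑ j ∈ Finset.Icc 1 τ, K * s * (1 + φ) ^ (j - 1 - k0) := Finset.sum_le_sum hXabs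
      _ ≤ K * s * (τ + (D - 1) / φ) := by
          rw [← Finset.mul_sum]; gcongr; exact geom1 φ hφ k0 τ
      _ ≤ K * s * (D / φ + D / φ) := by
          gcongr
          · linarith
          · linarith
      _ = _ := by ring
  have hsum2 : ∑ j ∈ Finset.Icc 1 τ, X (j - 1) ω ^ 2 ≤ 2 * K ^ 2 * s ^ 2 * D ^ 2 / φ := by
    calc _ ≤ ∑ j ∈ Finset.Icc 1 τ, (K * s) ^ 2 * ((1 + φ) ^ (j - 1 - k0)) ^ 2 := by
          refine Finset.sum_le_sum fun j hj => ?_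
          rw [← mul_pow, ← sq_abs]
          have := hXabs j hj
          gcongr
      _ ≤ (K * s) ^ 2 * (τ + (D ^ 2 - 1) / φ) := by
          rw [← Finset.mul_sum]; gcongr; exact geom2 φ hφ k0 τ
      _ ≤ (K * s) ^ 2 * (D ^ 2 / φ + D ^ 2 / φ) := by
          gcongr
          · linarith
          · linarith
      _ = _ := by ring
  have hxb := xbar_abs X τ ω hτ _ hsum1
  -- increments
  have hDD : DD X τ ω ≤ 4 * φ * K ^ 2 * s ^ 2 * D ^ 2 + 2 * K * s ^ 2 := by
    calc DD X τ ω ≤ ∑ j ∈ Finset.Icc 1 τ, (2 * φ ^ 2 * X (j - 1) ω ^ 2 + 2 * u j ^ 2) := by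
          refine Finset.sum_le_sum fun j hj => ?_
          rw [Finset.mem_Icc] at hj
          rw [hu j hj.1 hj.2]
          split_ifs
          · nlinarith [sq_nonneg (φ * X (j - 1) ω - u j)]
          · have := sq_nonneg (φ * X (j - 1) ω)
            nlinarith [sq_nonneg (u j)]
      _ = 2 * φ ^ 2 * ∑ j ∈ Finset.Icc 1 τ, X (j - 1) ω ^ 2 + 2 * ∑ j ∈ Finset.Icc 1 τ, u j ^ 2 := by
          rw [Finset.sum_add_distrib, Finset.mul_sum, Finset.mul_sum]
      _ ≤ 2 * φ ^ 2 * (2 * K ^ 2 * s ^ 2 * D ^ 2 / φ) + 2 * (K * s ^ 2) := by gcongr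
      _ = _ := by field_simp; ring
  have hXτ : |X τ ω| ≤ D * (K * s) := by
    rw [hY τ le_rfl, abs_mul, abs_of_pos hD0]; gcongr; exact hYK τ le_rfl
  have hXτ' : D * (a * s) ≤ |X τ ω| := by
    rw [hY τ le_rfl, abs_mul, abs_of_pos hD0]; gcongr
  have hX0 : |X 0 ω| ≤ K * s := by
    have := hY 0 (Nat.zero_le _)
    rw [Nat.zero_sub, pow_zero, one_mul] at this
    rw [this]; exact hYK 0 (Nat.zero_le _)
  have hA : D ^ 2 * a ^ 2 * s ^ 2 / 4 ≤ AA X τ ω := by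
    have e := AA_eq X τ ω
    have p1 : (D * (a * s)) ^ 2 ≤ X τ ω ^ 2 := by rw [← sq_abs (X τ ω)]; gcongr
    have p0 : X 0 ω ^ 2 ≤ (K * s) ^ 2 := by rw [← sq_abs]; gcongr
    have p2 : |xbar X τ ω * (X τ ω - X 0 ω)| ≤ (2 * K * s * D / φ / τ) * (2 * (D * (K * s))) := by
      rw [abs_mul]
      gcongr
      refine (abs_sub _ _).trans ?_
      have : K * s ≤ D * (K * s) := le_mul_of_one_le_left (by positivity) hD1
      linarith
    have p3 := le_abs_self (xbar X τ ω * (X τ ω - X 0 ω))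
    have p4 : (2 * K * s * D / φ / τ) * (2 * (D * (K * s))) = 4 * K ^ 2 / (φ * τ) * (D ^ 2 * s ^ 2) := by
      field_simp; ring
    have p5 : (K * s) ^ 2 + 2 * K * s ^ 2 ≤ 2 * (2 * K ^ 2 / n * (D ^ 2 * s ^ 2)) := by
      calc (K * s) ^ 2 + 2 * K * s ^ 2 ≤ 4 * K ^ 2 * s ^ 2 * 1 := by
            have : K * s ^ 2 ≤ K ^ 2 * s ^ 2 := by gcongr; nlinarith
            nlinarith [sq_nonneg (K * s)]
        _ ≤ 4 * K ^ 2 * s ^ 2 * (D ^ 2 / n) := by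
            gcongr
            rw [le_div_iff₀ hn0, one_mul]; exact hnD2
        _ = _ := by ring
    have p6 := mul_le_mul_of_nonneg_right hc (show 0 ≤ D ^ 2 * s ^ 2 by positivity)
    rw [p4] at p2
    have q1 : (D * (a * s)) ^ 2 = a ^ 2 * (D ^ 2 * s ^ 2) := by ring
    have q2 : 4 * φ * K ^ 2 * s ^ 2 * D ^ 2 = 4 * (φ * K ^ 2 * (D ^ 2 * s ^ 2)) := by ring
    have q3 : D ^ 2 * a ^ 2 * s ^ 2 / 4 = a ^ 2 * (D ^ 2 * s ^ 2) / 4 := by ring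
    rw [q1] at p1
    rw [q2] at hDD
    rw [q3]
    linarith
  have hAp : 0 < AA X τ ω := lt_of_lt_of_le (by positivity) hA
  have hSp : 0 < SS X τ ω := by
    rcases (SS_nonneg X τ ω).eq_or_lt with hz | hz
    · exfalso
      have hz' := hz.symm
      rw [SS, Finset.sum_eq_zero_iff_of_nonneg fun _ _ => sq_nonneg _] at hz'
      have : AA X τ ω = 0 := by
        refine Finset.sum_eq_zero fun j hj => ?_
        have := hz' j hj
        rw [pow_eq_zero_iff (by norm_num)] at this
        rw [this, zero_mul]
      linarith
    · exact hz
  have hSle := (SS_le X τ ω hτ).trans hsum2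
  -- residuals
  have hR : sigmaHatSq X τ ω * τ ≤ 14 * K ^ 2 * s ^ 2 * D ^ 2 / τ := by
    have hxb2 : xbar X τ ω ^ 2 ≤ (2 * K * s * D / φ / τ) ^ 2 := by rw [← sq_abs]; gcongr
    calc _ ≤ _ := sigma_le X τ ω hτ hSp φ
      _ ≤ ∑ j ∈ Finset.Icc 1 τ, (3 * u j ^ 2 + 3 * φ ^ 2 * (K * s) ^ 2 + 3 * φ ^ 2 * xbar X τ ω ^ 2) := by
          refine Finset.sum_le_sum fun j hj => ?_
          have hXj := hXabs j hj
          rw [Finset.mem_Icc] at hj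
          rw [hu j hj.1 hj.2]
          simp only [xtil]
          split_ifs with hk
          · have := sq_nonneg (φ * (K * s))
            nlinarith [sq_nonneg (u j - φ * xbar X τ ω), sq_nonneg (φ * xbar X τ ω), sq_nonneg (u j)]
          · have h0 : j - 1 - k0 = 0 := by omega
            rw [h0, pow_zero, mul_one] at hXj
            have h2 : X (j - 1) ω ^ 2 ≤ (K * s) ^ 2 := by rw [← sq_abs]; gcongr
            have h3 : φ ^ 2 * X (j - 1) ω ^ 2 ≤ φ ^ 2 * (K * s) ^ 2 := by gcongr
            nlinarith [sq_nonneg (u j - φ * xbar X τ ω), sq_nonneg (u j + φ * X (j - 1) ω),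
              sq_nonneg (φ * X (j - 1) ω + φ * xbar X τ ω)]
      _ = 3 * ∑ j ∈ Finset.Icc 1 τ, u j ^ 2 + τ * (3 * φ ^ 2 * (K * s) ^ 2)
            + τ * (3 * φ ^ 2 * xbar X τ ω ^ 2) := by
          rw [Finset.sum_add_distrib, Finset.sum_add_distrib, Finset.mul_sum]
          simp
      _ ≤ 3 * (K * s ^ 2) + τ * (3 * 1 ^ 2 * (K * s) ^ 2)
            + τ * (3 * φ ^ 2 * (2 * K * s * D / φ / τ) ^ 2) := by gcongr
      _ ≤ 6 * (n * (K ^ 2 * s ^ 2)) + 12 * K ^ 2 * s ^ 2 * D ^ 2 / τ := by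
          have e1 : τ * (3 * φ ^ 2 * (2 * K * s * D / φ / τ) ^ 2) = 12 * K ^ 2 * s ^ 2 * D ^ 2 / τ := by
            field_simp; ring
          have e2 : K * s ^ 2 ≤ n * (K ^ 2 * s ^ 2) := by
            have : K ≤ n * K ^ 2 := by nlinarith
            nlinarith [sq_nonneg s]
          have e3 : τ * (K * s) ^ 2 ≤ n * (K ^ 2 * s ^ 2) := by rw [mul_pow]; gcongr
          rw [e1]; nlinarith
      _ ≤ 2 * K ^ 2 * s ^ 2 * D ^ 2 / τ + 12 * K ^ 2 * s ^ 2 * D ^ 2 / τ := by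
          gcongr
          rw [le_div_iff₀ hτ0]
          have : 9 * ((n : ℝ) * n) ≤ D ^ 2 := by nlinarith
          have h2 : (n : ℝ) * τ ≤ n * n := by gcongr
          have h3 : 3 * ((n : ℝ) * τ) ≤ D ^ 2 := by nlinarith [mul_pos hn0 hτ0]
          have := mul_le_mul_of_nonneg_left h3 (show 0 ≤ 2 * (K ^ 2 * s ^ 2) by positivity)
          nlinarith
      _ = _ := by ring
  have hqle : sigmaHatSq X τ ω ≤ 14 * K ^ 2 * s ^ 2 * D ^ 2 / τ ^ 2 := by
    rw [← le_div_iff₀ hτ0] at hR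
    refine hR.trans (le_of_eq ?_)
    field_simp
  rw [T_eq X τ ω hτ hSp hq, le_div_iff₀ (Real.sqrt_pos.2 (mul_pos hSp hq))]
  have hφs : 0 < Real.sqrt φ := Real.sqrt_pos.2 hφ
  have hφ2 : Real.sqrt φ ^ 2 = φ := Real.sq_sqrt hφ.le
  have hG : Real.sqrt (SS X τ ω * sigmaHatSq X τ ω) ≤
      6 * K ^ 2 * s ^ 2 * D ^ 2 / (Real.sqrt φ * τ) := by
    rw [Real.sqrt_le_left (by positivity)]
    calc _ ≤ (2 * K ^ 2 * s ^ 2 * D ^ 2 / φ) * (14 * K ^ 2 * s ^ 2 * D ^ 2 / τ ^ 2) := by gcongr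
      _ = 28 * (K ^ 4 * s ^ 4 * D ^ 4 / (φ * τ ^ 2)) := by field_simp; ring
      _ ≤ 36 * (K ^ 4 * s ^ 4 * D ^ 4 / (φ * τ ^ 2)) := by gcongr; norm_num
      _ = _ := by
        rw [div_pow, mul_pow (Real.sqrt φ), hφ2]; field_simp; ring
  calc _ ≤ a ^ 2 / (24 * K ^ 2) * (Real.sqrt φ * τ) *
        (6 * K ^ 2 * s ^ 2 * D ^ 2 / (Real.sqrt φ * τ)) := by gcongr
    _ = D ^ 2 * a ^ 2 * s ^ 2 / 4 := by field_simp; ring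
    _ ≤ _ := hA

end paths2

section bracket

variable {Ω : Type*} [mΩ : MeasurableSpace Ω] (P : ℕ → Measure Ω) (σ : ℕ → ℕ → Ω → ℝ)

theorem sum_var_pos (hP : ∀ n, IsProbabilityMeasure (P n))
    (hσpos : ∀ n t, 1 ≤ t → t ≤ n → ∀ ω, 0 < σ n t ω)
    (hσint : ∀ n t, 1 ≤ t → t ≤ n → Integrable (fun ω => (σ n t ω) ^ 2) (P n))
    {n k : ℕ} (hk : 1 ≤ k) (hkn : k ≤ n) :
    0 < ∑ t ∈ Finset.Icc 1 k, ∫ ω, (σ n t ω) ^ 2 ∂(P n) := by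
  refine Finset.sum_pos (fun t ht => ?_) ⟨1, Finset.mem_Icc.2 ⟨le_rfl, hk⟩⟩
  rw [Finset.mem_Icc] at ht
  rw [integral_pos_iff_support_of_nonneg (fun ω => sq_nonneg _) (hσint n t ht.1 (by omega))]
  have : Function.support (fun ω => (σ n t ω) ^ 2) = Set.univ := by
    ext ω
    simp [(hσpos n t ht.1 (by omega) ω).ne']
  rw [this]
  have := hP n
  simp

theorem avgVar_mul {n k : ℕ} (hk : 1 ≤ k) :
    (k : ℝ) * avgVar P σ n k = ∑ t ∈ Finset.Icc 1 k, ∫ ω, (σ n t ω) ^ 2 ∂(P n) := by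
  have : (k : ℝ) ≠ 0 := by positivity
  rw [avgVar, mul_div_cancel₀ _ this]

theorem floor_div_tendsto (r : ℝ) (hr : 0 ≤ r) :
    Tendsto (fun n : ℕ => (⌊(n : ℝ) * r⌋₊ : ℝ) / n) atTop (nhds r) := by
  have := (tendsto_nat_floor_mul_div_atTop hr).comp (tendsto_natCast_atTop_atTop (R := ℝ))
  refine this.congr fun n => ?_
  simp [mul_comm]

theorem bracket_pt (hP : ∀ n, IsProbabilityMeasure (P n))
    (hσpos : ∀ n t, 1 ≤ t → t ≤ n → ∀ ω, 0 < σ n t ω)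
    (hσint : ∀ n t, 1 ≤ t → t ≤ n → Integrable (fun ω => (σ n t ω) ^ 2) (P n))
    (hA1 : ∀ r ∈ Set.Ioc (0 : ℝ) 1, ∀ εp : ℝ, 0 < εp →
      Tendsto (fun n : ℕ => P n {ω |
          εp ≤ |(∑ t ∈ Finset.Icc 1 ⌊(n : ℝ) * r⌋₊, (σ n t ω) ^ 2) /
            ((⌊(n : ℝ) * r⌋₊ : ℝ) * avgVar P σ n ⌊(n : ℝ) * r⌋₊) - 1|})
        atTop (nhds 0))
    (hA2 : ∃ ζ ∈ Set.Ioo (0 : ℝ) 1, ∃ g : ℕ → ℝ,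
      g =o[atTop] (fun n : ℕ => (n : ℝ) ^ (-(1 : ℝ) / 2)) ∧
      ∀ n t : ℕ, (n : ℝ) ^ ζ < (t : ℝ) → t ≤ n →
        |avgVar P σ n t / avgVar P σ n n - 1| ≤ g n)
    (r : ℝ) (hr : r ∈ Set.Ioc (0 : ℝ) 1) (η : ℝ) (hη : 0 < η) :
    Tendsto (fun n : ℕ => P n {ω | η ≤ |(∑ t ∈ Finset.Icc 1 ⌊(n : ℝ) * r⌋₊, (σ n t ω) ^ 2) /
      ((n : ℝ) * avgVar P σ n n) - r|}) atTop (nhds 0) := by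
  obtain ⟨ζ, hζ, g, hg, hgA⟩ := hA2
  have hg0 : Tendsto g atTop (nhds 0) := by
    refine hg.trans_tendsto ?_
    have := (tendsto_rpow_neg_atTop (show (0 : ℝ) < 1 / 2 by norm_num)).comp
      (tendsto_natCast_atTop_atTop (R := ℝ))
    refine this.congr fun n => ?_
    simp only [Function.comp]; norm_num
  have hfl := floor_div_tendsto r hr.1.le
  have hpw : Tendsto (fun n : ℕ => (n : ℝ) ^ ζ / n) atTop (nhds 0) := by
    have := (tendsto_rpow_neg_atTop (show (0 : ℝ) < 1 - ζ by linarith [hζ.2])).comp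
      (tendsto_natCast_atTop_atTop (R := ℝ))
    refine this.congr' ?_
    filter_upwards [eventually_gt_atTop 0] with n hn
    have hn' : (0 : ℝ) < n := by exact_mod_cast hn
    simp only [Function.comp]
    rw [neg_sub, Real.rpow_sub_one hn'.ne']
  have hkn : ∀ n : ℕ, ⌊(n : ℝ) * r⌋₊ ≤ n := by
    intro n
    apply Nat.floor_le_of_le
    have : (0 : ℝ) ≤ n := Nat.cast_nonneg n
    nlinarith [hr.2]
  have hbig : ∀ᶠ n : ℕ in atTop, (n : ℝ) ^ ζ < (⌊(n : ℝ) * r⌋₊ : ℝ) := by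
    have h1 := hpw.eventually_lt_const (show (0 : ℝ) < r / 2 by linarith [hr.1])
    have h2 := hfl.eventually_const_lt (show r / 2 < r by linarith [hr.1])
    filter_upwards [h1, h2, eventually_gt_atTop 0] with n h1 h2 hn
    have hn' : (0 : ℝ) < n := by exact_mod_cast hn
    have := h1.trans h2
    rwa [div_lt_div_iff_of_pos_right hn'] at this
  have hm : Tendsto (fun n : ℕ => avgVar P σ n ⌊(n : ℝ) * r⌋₊ / avgVar P σ n n) atTop (nhds 1) := by
    rw [tendsto_iff_norm_sub_tendsto_zero]
    refine tendsto_of_tendsto_of_tendsto_of_le_of_le' tendsto_const_nhds hg0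
      (Eventually.of_forall fun n => norm_nonneg _) ?_
    filter_upwards [hbig] with n hn
    exact hgA n _ hn (hkn n)
  have hc : Tendsto (fun n : ℕ => ((⌊(n : ℝ) * r⌋₊ : ℝ) / n) *
      (avgVar P σ n ⌊(n : ℝ) * r⌋₊ / avgVar P σ n n)) atTop (nhds r) := by
    simpa using hfl.mul hm
  have hc1 := hc.eventually_lt_const (show r < 2 by linarith [hr.2])
  have hc2 := (Metric.tendsto_atTop.1 hc (η / 2) (by linarith))
  obtain ⟨N0, hN0⟩ := hc2
  refine tendsto_of_tendsto_of_tendsto_of_le_of_le' tendsto_const_nhds (hA1 r hr (η / 4) (by linarith))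
    (Eventually.of_forall fun n => zero_le) ?_
  filter_upwards [hc1, hbig, eventually_ge_atTop N0, eventually_gt_atTop 0] with n h1 h2 h3 h4
  have hn' : (0 : ℝ) < n := by exact_mod_cast h4
  have h3' := hN0 n h3
  rw [Real.dist_eq] at h3'
  refine measure_mono fun ω hω => ?_
  have hω' : η ≤ |(∑ t ∈ Finset.Icc 1 ⌊(n : ℝ) * r⌋₊, (σ n t ω) ^ 2) /
      ((n : ℝ) * avgVar P σ n n) - r| := hω
  change η / 4 ≤ |(∑ t ∈ Finset.Icc 1 ⌊(n : ℝ) * r⌋₊, (σ n t ω) ^ 2) /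
            ((⌊(n : ℝ) * r⌋₊ : ℝ) * avgVar P σ n ⌊(n : ℝ) * r⌋₊) - 1|
  set k := ⌊(n : ℝ) * r⌋₊ with hk
  have hk0 : (0 : ℝ) < k := lt_of_le_of_lt (by positivity) h2
  have hk1 : 1 ≤ k := by exact_mod_cast hk0
  have q1 : 0 < (k : ℝ) * avgVar P σ n k := by
    rw [avgVar_mul P σ hk1]; exact sum_var_pos P σ hP hσpos hσint hk1 (hkn n)
  have q2 : 0 < (n : ℝ) * avgVar P σ n n := by
    rw [avgVar_mul P σ h4]; exact sum_var_pos P σ hP hσpos hσint h4 le_rfl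
  have q1' : 0 < avgVar P σ n k := pos_of_mul_pos_right q1 hk0.le
  have q2' : 0 < avgVar P σ n n := pos_of_mul_pos_right q2 hn'.le
  set V := ∑ t ∈ Finset.Icc 1 k, (σ n t ω) ^ 2
  set C := (k : ℝ) / n * (avgVar P σ n k / avgVar P σ n n) with hC
  have hC0 : 0 < C := by positivity
  have e : V / ((n : ℝ) * avgVar P σ n n) = V / ((k : ℝ) * avgVar P σ n k) * C := by
    rw [hC]; field_simp
  rw [e] at hω'
  by_contra hneg
  push Not at hneg
  have : V / ((k : ℝ) * avgVar P σ n k) * C - r = (V / ((k : ℝ) * avgVar P σ n k) - 1) * C + (C - r) := by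
    ring
  rw [this] at hω'
  have h5 := abs_add_le ((V / ((k : ℝ) * avgVar P σ n k) - 1) * C) (C - r)
  rw [abs_mul, abs_of_pos hC0] at h5
  have h6 : |V / ((k : ℝ) * avgVar P σ n k) - 1| * C ≤ η / 4 * 2 := by gcongr
  linarith

theorem bracket_unif (hP : ∀ n, IsProbabilityMeasure (P n))
    (hσpos : ∀ n t, 1 ≤ t → t ≤ n → ∀ ω, 0 < σ n t ω)
    (hσint : ∀ n t, 1 ≤ t → t ≤ n → Integrable (fun ω => (σ n t ω) ^ 2) (P n))
    (hpt : ∀ r ∈ Set.Ioc (0 : ℝ) 1, ∀ η : ℝ, 0 < η →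
      Tendsto (fun n : ℕ => P n {ω | η ≤ |(∑ t ∈ Finset.Icc 1 ⌊(n : ℝ) * r⌋₊, (σ n t ω) ^ 2) /
      ((n : ℝ) * avgVar P σ n n) - r|}) atTop (nhds 0))
    (η : ℝ) (hη : 0 < η) :
    Tendsto (fun n : ℕ => P n {ω | ∃ k ≤ n, η < |(∑ t ∈ Finset.Icc 1 k, (σ n t ω) ^ 2) /
      ((n : ℝ) * avgVar P σ n n) - (k : ℝ) / n|}) atTop (nhds 0) := by
  obtain ⟨L, hL⟩ := exists_nat_gt (2 / η)
  have hL0 : (0 : ℝ) < L := lt_trans (by positivity) hL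
  have hL0' : 0 < L := by exact_mod_cast hL0
  have hLη : 1 / (L : ℝ) < η / 2 := by
    rw [div_lt_iff₀ hη] at hL
    rw [div_lt_div_iff₀ hL0 (by norm_num)]; linarith
  set B : ℕ → ℕ → Set Ω := fun j n => {ω | η / 4 ≤
    |(∑ t ∈ Finset.Icc 1 ⌊(n : ℝ) * ((j : ℝ) / L)⌋₊, (σ n t ω) ^ 2) /
      ((n : ℝ) * avgVar P σ n n) - (j : ℝ) / L|} with hB
  have hsum : Tendsto (fun n : ℕ => ∑ j ∈ Finset.Icc 1 L, P n (B j n)) atTop (nhds 0) := by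
    have := tendsto_finsetSum (f := fun j n => P n (B j n)) (x := atTop) (a := fun _ => 0)
      (Finset.Icc 1 L) (fun j hj => ?_)
    · simpa using this
    · rw [Finset.mem_Icc] at hj
      have hj1 : (0 : ℝ) < j := by exact_mod_cast hj.1
      refine hpt ((j : ℝ) / L) ⟨by positivity, ?_⟩ (η / 4) (by linarith)
      rw [div_le_one hL0]; exact_mod_cast hj.2
  refine tendsto_of_tendsto_of_tendsto_of_le_of_le' tendsto_const_nhds hsum
    (Eventually.of_forall fun n => zero_le) ?_
  filter_upwards [eventually_gt_atTop 0] with n hn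
  have hn' : (0 : ℝ) < n := by exact_mod_cast hn
  refine le_trans (measure_mono ?_) (measure_biUnion_finset_le (Finset.Icc 1 L) (fun j => B j n))
  rintro ω ⟨k, hk, hkη⟩
  have hs : 0 < (n : ℝ) * avgVar P σ n n := by
    rw [avgVar_mul P σ hn]; exact sum_var_pos P σ hP hσpos hσint hn le_rfl
  by_contra hneg
  have hgood : ∀ j, j ≤ L → |(∑ t ∈ Finset.Icc 1 ⌊(n : ℝ) * ((j : ℝ) / L)⌋₊, (σ n t ω) ^ 2) /
      ((n : ℝ) * avgVar P σ n n) - (j : ℝ) / L| < η / 4 := by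
    intro j hj
    rcases Nat.eq_zero_or_pos j with h0 | h0
    · subst h0; simp; linarith
    · by_contra hcon
      push Not at hcon
      exact hneg (Set.mem_biUnion (by simpa using ⟨h0, hj⟩ : j ∈ (Finset.Icc 1 L)) hcon)
  -- pick the grid cell
  obtain ⟨j, hjL, hj1, hj2⟩ : ∃ j, j + 1 ≤ L ∧ (j : ℝ) / L ≤ (k : ℝ) / n ∧
      (k : ℝ) / n ≤ ((j + 1 : ℕ) : ℝ) / L := by
    rcases hk.eq_or_lt with h | h
    · refine ⟨L - 1, by omega, ?_, ?_⟩
      · subst h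
        rw [div_self hn'.ne', div_le_one hL0]; exact_mod_cast Nat.sub_le _ _
      · subst h
        rw [Nat.sub_add_cancel hL0', div_self hn'.ne', div_self hL0.ne']
    · refine ⟨⌊(k : ℝ) / n * L⌋₊, ?_, ?_, ?_⟩
      · have : (k : ℝ) / n < 1 := by rw [div_lt_one hn']; exact_mod_cast h
        have h2 : (k : ℝ) / n * L < L := by nlinarith
        exact (Nat.floor_lt (by positivity)).2 h2
      · rw [div_le_iff₀ hL0]; exact Nat.floor_le (by positivity)
      · rw [le_div_iff₀ hL0]; push_cast; exact (Nat.lt_floor_add_one _).le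
  have g1 := hgood j (by omega)
  have g2 := hgood (j + 1) hjL
  have f1 : ⌊(n : ℝ) * ((j : ℝ) / L)⌋₊ ≤ k := by
    apply Nat.floor_le_of_le
    rw [le_div_iff₀ hn'] at hj1; linarith
  have f2 : k ≤ ⌊(n : ℝ) * (((j + 1 : ℕ) : ℝ) / L)⌋₊ := by
    apply Nat.le_floor
    rw [div_le_iff₀ hn'] at hj2; linarith
  have mono : ∀ a b : ℕ, a ≤ b → (∑ t ∈ Finset.Icc 1 a, (σ n t ω) ^ 2) / ((n : ℝ) * avgVar P σ n n) ≤
      (∑ t ∈ Finset.Icc 1 b, (σ n t ω) ^ 2) / ((n : ℝ) * avgVar P σ n n) := by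
    intro a b hab
    gcongr
  have m1 := mono _ _ f1
  have m2 := mono _ _ f2
  have e : ((j + 1 : ℕ) : ℝ) / L = (j : ℝ) / L + 1 / L := by push_cast; ring
  rw [abs_lt] at g1 g2
  have : |(∑ t ∈ Finset.Icc 1 k, (σ n t ω) ^ 2) / ((n : ℝ) * avgVar P σ n n) - (k : ℝ) / n| ≤ η := by
    rw [abs_le]
    constructor
    · linarith [g1.1]
    · linarith [g2.2]
  linarith

end bracket

section normalized

variable {Ω : Type*} [mΩ : MeasurableSpace Ω] {μ : Measure Ω} {ℱ : ℕ → MeasurableSpace Ω}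
  {n : ℕ} {v ε : ℕ → Ω → ℝ}

theorem M1 (h : GS μ ℱ n v ε) [IsProbabilityMeasure μ] (s : ℝ) (hs : 0 < s)
    (hsum : ∑ i ∈ Finset.Icc 1 n, ∫⁻ ω, ENNReal.ofReal (v i ω ^ 2) ∂μ ≤ ENNReal.ofReal (s ^ 2))
    (w : ℕ → ℝ) (hw0 : ∀ i, 0 ≤ w i) (hw1 : ∀ i, w i ≤ 1) (K : ℝ) (hK : 0 < K) :
    μ {ω | ∃ t ≤ n, K * s ≤ |∑ i ∈ Finset.Icc 1 t, w i * (v i ω * ε i ω)|} ≤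
      ENNReal.ofReal (1 / K ^ 2) := by
  have h1 := (h.scale w).maxineq (K * s) (by positivity)
  simp only [mul_assoc] at h1
  refine h1.trans ?_
  have h2 : ∑ i ∈ Finset.Icc 1 n, ∫⁻ ω, ENNReal.ofReal ((w i * v i ω) ^ 2) ∂μ ≤
      ENNReal.ofReal (s ^ 2) := by
    refine (Finset.sum_le_sum fun i _ => lintegral_mono fun ω => ?_).trans hsum
    apply ENNReal.ofReal_le_ofReal
    rw [mul_pow]
    have : w i ^ 2 ≤ 1 := pow_le_one₀ (hw0 i) (hw1 i)
    nlinarith [sq_nonneg (v i ω)]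
  refine (ENNReal.div_le_div_right h2 _).trans ?_
  rw [← ENNReal.ofReal_div_of_pos (by positivity)]
  apply ENNReal.ofReal_le_ofReal
  apply le_of_eq
  field_simp

theorem M2 (h : GS μ ℱ n v ε) [IsProbabilityMeasure μ] (s : ℝ) (hs : 0 < s)
    (hsum : ∑ i ∈ Finset.Icc 1 n, ∫⁻ ω, ENNReal.ofReal (v i ω ^ 2) ∂μ ≤ ENNReal.ofReal (s ^ 2))
    (K : ℝ) (hK : 0 < K) :
    μ {ω | K * s ^ 2 ≤ ∑ i ∈ Finset.Icc 1 n, (v i ω * ε i ω) ^ 2} ≤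
      ENNReal.ofReal (1 / K) := by
  refine (h.usq (K * s ^ 2) (by positivity)).trans ?_
  refine (ENNReal.div_le_div_right hsum _).trans ?_
  rw [← ENNReal.ofReal_div_of_pos (by positivity)]
  apply ENNReal.ofReal_le_ofReal
  apply le_of_eq
  field_simp

theorem M3 (h : GS μ ℱ n v ε) [IsProbabilityMeasure μ] (s : ℝ) (hs : 0 < s) (N : ℕ) (hN : N ≤ n)
    (w : ℕ → ℝ) (Y0 : Ω → ℝ) (hY0 : Measurable[ℱ 0] Y0) (a b : ℝ) (ha : 0 < a) (hb : 0 < b) :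
    μ {ω | |Y0 ω + ∑ i ∈ Finset.Icc 1 N, w i * (v i ω * ε i ω)| ≤ a * s ∧
      |(∑ i ∈ Finset.Icc 1 N, w i ^ 2 * v i ω ^ 2) / s ^ 2 - b| ≤ a ^ 2} ≤
      ENNReal.ofReal (3 * a / √b) := by
  have h1 := ((h.shrink hN).scale (fun i => w i / s)).anticonc (fun ω => Y0 ω / s)
    (hY0.div_const s) a b ha hb
  refine (measure_mono ?_).trans h1
  rintro ω ⟨h2, h3⟩
  refine ⟨?_, ?_⟩
  · have : Y0 ω / s + ∑ i ∈ Finset.Icc 1 N, w i / s * v i ω * ε i ω =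
        (Y0 ω + ∑ i ∈ Finset.Icc 1 N, w i * (v i ω * ε i ω)) / s := by
      rw [add_div, Finset.sum_div]
      congr 1
      refine Finset.sum_congr rfl fun i _ => by ring
    change |Y0 ω / s + ∑ i ∈ Finset.Icc 1 N, w i / s * v i ω * ε i ω| ≤ a
    rw [this, abs_div, abs_of_pos hs, div_le_iff₀ hs]
    exact h2
  · have : ∑ i ∈ Finset.Icc 1 N, (w i / s * v i ω) ^ 2 =
        (∑ i ∈ Finset.Icc 1 N, w i ^ 2 * v i ω ^ 2) / s ^ 2 := by
      rw [Finset.sum_div]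
      refine Finset.sum_congr rfl fun i _ => by ring
    change |∑ i ∈ Finset.Icc 1 N, (w i / s * v i ω) ^ 2 - b| ≤ a ^ 2
    rw [this]
    exact h3

theorem M4 (h : GS μ ℱ n v ε) [IsProbabilityMeasure μ] (s : ℝ) (hs : 0 < s) (N : ℕ) (hN : N ≤ n)
    (κ ρ θ : ℝ) (hθ : 0 < θ) (hρ : 0 < ρ) :
    μ {ω | ∑ i ∈ Finset.Icc 1 N, (v i ω * ε i ω) ^ 2 ≤ κ * s ^ 2 ∧
      ρ ≤ (∑ i ∈ Finset.Icc 1 N, v i ω ^ 2) / s ^ 2} ≤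
      ENNReal.ofReal (Real.exp (θ * κ) / √(1 + 2 * θ * ρ)) := by
  have h1 := ((h.shrink hN).scale (fun _ => 1 / s)).lower κ ρ θ hθ hρ
  refine (measure_mono ?_).trans h1
  rintro ω ⟨h2, h3⟩
  refine ⟨?_, ?_⟩
  · have : ∑ i ∈ Finset.Icc 1 N, (1 / s * v i ω * ε i ω) ^ 2 =
        (∑ i ∈ Finset.Icc 1 N, (v i ω * ε i ω) ^ 2) / s ^ 2 := by
      rw [Finset.sum_div]
      refine Finset.sum_congr rfl fun i _ => by ring
    change ∑ i ∈ Finset.Icc 1 N, (1 / s * v i ω * ε i ω) ^ 2 ≤ κ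
    rw [this, div_le_iff₀ (by positivity)]
    exact h2
  · have : ∑ i ∈ Finset.Icc 1 N, (1 / s * v i ω) ^ 2 =
        (∑ i ∈ Finset.Icc 1 N, v i ω ^ 2) / s ^ 2 := by
      rw [Finset.sum_div]
      refine Finset.sum_congr rfl fun i _ => by ring
    change ρ ≤ ∑ i ∈ Finset.Icc 1 N, (1 / s * v i ω) ^ 2
    rw [this]
    exact h3

open Classical in
theorem markov_count (m : ℕ) (hm : 1 ≤ m) (E : ℕ → Set Ω) (p : ℝ) (hp : 0 ≤ p)
    (hE : ∀ i < m, μ (E i) ≤ ENNReal.ofReal p) :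
    μ {ω | (m : ℝ) / 2 ≤ (((Finset.range m).filter (fun i => ω ∈ E i)).card : ℝ)} ≤
      ENNReal.ofReal (2 * p) := by
  set F : Ω → ENNReal := fun ω => ∑ i ∈ Finset.range m,
    (toMeasurable μ (E i)).indicator (fun _ => 1) ω with hF
  have hFm : Measurable F := by
    refine Finset.measurable_fun_sum _ fun i _ => ?_
    exact measurable_const.indicator (measurableSet_toMeasurable _ _)
  have hIntg : ∫⁻ ω, F ω ∂μ ≤ ENNReal.ofReal (m * p) := by
    rw [lintegral_finsetSum _ fun i _ => measurable_const.indicator (measurableSet_toMeasurable _ _)]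
    have : ∀ i ∈ Finset.range m, ∫⁻ ω, (toMeasurable μ (E i)).indicator (fun _ => (1 : ENNReal)) ω ∂μ
        ≤ ENNReal.ofReal p := by
      intro i hi
      rw [lintegral_indicator (measurableSet_toMeasurable _ _)]
      simp only [lintegral_const, MeasurableSet.univ, Measure.restrict_apply, Set.univ_inter, one_mul,
        measure_toMeasurable]
      exact hE i (Finset.mem_range.1 hi)
    refine (Finset.sum_le_sum this).trans ?_
    rw [Finset.sum_const, Finset.card_range, nsmul_eq_mul, ENNReal.ofReal_mul (by positivity)]
    simp
  have hm0 : (0 : ℝ) < m := by exact_mod_cast hm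
  have h1 := meas_ge_le_lintegral_div (μ := μ) hFm.aemeasurable
    (ε := ENNReal.ofReal ((m : ℝ) / 2)) (by simpa using by omega) (by simp)
  refine (measure_mono ?_).trans (h1.trans ?_)
  · intro ω hω
    have hω' : (m : ℝ) / 2 ≤ (((Finset.range m).filter (fun i => ω ∈ E i)).card : ℝ) := hω
    change ENNReal.ofReal ((m : ℝ) / 2) ≤ F ω
    refine (ENNReal.ofReal_le_ofReal hω').trans ?_
    rw [ENNReal.ofReal_natCast, Finset.card_filter]
    push_cast
    refine Finset.sum_le_sum fun i _ => ?_
    by_cases hi : ω ∈ E i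
    · have := subset_toMeasurable μ (E i) hi
      simp [hi, this]
    · simp [hi]
  · refine (ENNReal.div_le_div_right hIntg _).trans ?_
    rw [← ENNReal.ofReal_div_of_pos (by positivity)]
    apply ENNReal.ofReal_le_ofReal
    apply le_of_eq
    field_simp

theorem M5 (h : GS μ ℱ n v ε) [IsProbabilityMeasure μ] (s : ℝ) (hs : 0 < s) (m : ℕ) (hm : 1 ≤ m)
    (hmn : m + m ≤ n) (a : ℝ) (ha : 0 < a) (U V : ℕ → Ω → ℝ)
    (hU : ∀ t ω, U t ω = ∑ i ∈ Finset.Icc 1 t, v i ω * ε i ω)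
    (hV : ∀ t ω, V t ω = ∑ i ∈ Finset.Icc 1 t, v i ω ^ 2) :
    μ {ω | ∑ i ∈ Finset.range m, (U (i + m) ω - U i ω) ^ 2 ≤ (m : ℝ) / 2 * (a ^ 2 * s ^ 2) ∧
      ∀ k ≤ n, |V k ω / s ^ 2 - (k : ℝ) / n| ≤ a ^ 2 / 2} ≤
      ENNReal.ofReal (2 * (3 * a / √((m : ℝ) / n))) := by
  classical
  have hm0 : (0 : ℝ) < m := by exact_mod_cast hm
  have hn0 : (0 : ℝ) < n := by exact_mod_cast (by omega : 0 < n)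
  set E : ℕ → Set Ω := fun i => {ω | |U (i + m) ω - U i ω| ≤ a * s ∧
    |(V (i + m) ω - V i ω) / s ^ 2 - (m : ℝ) / n| ≤ a ^ 2} with hE
  have split : ∀ (f : ℕ → ℝ) (i : ℕ), ∑ j ∈ Finset.Icc 1 (i + m), (if i < j then f j else 0) =
      ∑ j ∈ Finset.Icc 1 (i + m), f j - ∑ j ∈ Finset.Icc 1 i, f j := by
    intro f i
    have e : Finset.Icc 1 i = (Finset.Icc 1 (i + m)).filter (fun j => ¬ i < j) := by
      ext j; simp only [Finset.mem_Icc, Finset.mem_filter]; omega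
    rw [e, ← Finset.sum_filter, ← Finset.sum_filter_add_sum_filter_not (Finset.Icc 1 (i + m))
      (fun j => i < j) f]
    ring
  have hEp : ∀ i < m, μ (E i) ≤ ENNReal.ofReal (3 * a / √((m : ℝ) / n)) := by
    intro i hi
    have h3 := M3 h s hs (i + m) (by omega) (fun j => if i < j then 1 else 0) (fun _ => 0)
      measurable_const a ((m : ℝ) / n) ha (by positivity)
    refine (measure_mono ?_).trans h3
    rintro ω ⟨h4, h5⟩
    refine ⟨?_, ?_⟩
    · have := split (fun j => v j ω * ε j ω) i
      rw [← hU, ← hU] at this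
      simp only [zero_add, ite_mul, one_mul, zero_mul]
      rw [this]; exact h4
    · have := split (fun j => v j ω ^ 2) i
      rw [← hV, ← hV] at this
      simp only [ite_pow, one_pow, zero_pow two_ne_zero, ite_mul, one_mul, zero_mul]
      rw [this]; exact h5
  refine (measure_mono ?_).trans (markov_count m hm E _ (by positivity) hEp)
  rintro ω ⟨h4, h5⟩
  suffices hfin : (m : ℝ) / 2 ≤ (((Finset.range m).filter (fun i => ω ∈ E i)).card : ℝ) by
    rw [Set.mem_ofPred_eq]
    convert hfin
  have h6 : ∀ i ∈ Finset.range m, a ^ 2 * s ^ 2 * (1 - if ω ∈ E i then 1 else 0) ≤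
      (U (i + m) ω - U i ω) ^ 2 := by
    intro i hi
    rw [Finset.mem_range] at hi
    by_cases hω : ω ∈ E i
    · simp [hω]; positivity
    · simp only [hω, if_false, sub_zero, mul_one]
      have h7 : |(V (i + m) ω - V i ω) / s ^ 2 - (m : ℝ) / n| ≤ a ^ 2 := by
        have g1 := h5 (i + m) (by omega)
        have g2 := h5 i (by omega)
        have : (V (i + m) ω - V i ω) / s ^ 2 - (m : ℝ) / n =
          (V (i + m) ω / s ^ 2 - ((i + m : ℕ) : ℝ) / n) - (V i ω / s ^ 2 - (i : ℝ) / n) := by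
          push_cast; ring
        rw [this]
        refine (abs_sub _ _).trans ?_
        linarith
      have h8 : a * s < |U (i + m) ω - U i ω| := by
        by_contra hc
        push Not at hc
        exact hω ⟨hc, h7⟩
      rw [← mul_pow, ← sq_abs (U (i + m) ω - U i ω)]
      have : 0 ≤ a * s := by positivity
      gcongr
  have h7 := (Finset.sum_le_sum h6).trans h4
  rw [← Finset.mul_sum, Finset.sum_sub_distrib, Finset.sum_boole] at h7
  simp only [Finset.sum_const, Finset.card_range, nsmul_eq_mul, mul_one] at h7
  have hpos : 0 < a ^ 2 * s ^ 2 := by positivity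
  by_contra hc
  push Not at hc
  nlinarith

end normalized

section partOne

theorem union6 {Ω : Type*} [MeasurableSpace Ω] (μ : Measure Ω) (S A B C D E F : Set Ω) (x : ℝ)
    (hx : 0 < x) (hS : ∀ ω ∈ S, ω ∉ A → ω ∉ B → ω ∉ C → ω ∉ D → ω ∉ E → ω ∈ F)
    (hA : μ A ≤ ENNReal.ofReal (x / 6)) (hB : μ B ≤ ENNReal.ofReal (x / 6))
    (hC : μ C ≤ ENNReal.ofReal (x / 6)) (hD : μ D ≤ ENNReal.ofReal (x / 6))
    (hE : μ E ≤ ENNReal.ofReal (x / 6)) (hF : μ F ≤ ENNReal.ofReal (x / 6)) :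
    μ S ≤ ENNReal.ofReal x := by
  have h1 : S ⊆ A ∪ (B ∪ (C ∪ (D ∪ (E ∪ F)))) := by
    intro ω hω
    by_contra hc
    simp only [Set.mem_union, not_or] at hc
    exact hc.2.2.2.2.2 (hS ω hω hc.1 hc.2.1 hc.2.2.1 hc.2.2.2.1 hc.2.2.2.2.1)
  have e : ENNReal.ofReal x = ENNReal.ofReal (x / 6) + (ENNReal.ofReal (x / 6) +
      (ENNReal.ofReal (x / 6) + (ENNReal.ofReal (x / 6) + (ENNReal.ofReal (x / 6) +
      ENNReal.ofReal (x / 6))))) := by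
    have h6 : 0 ≤ x / 6 := by positivity
    rw [← ENNReal.ofReal_add (by positivity) (by positivity),
      ← ENNReal.ofReal_add (by positivity) (by positivity),
      ← ENNReal.ofReal_add (by positivity) (by positivity),
      ← ENNReal.ofReal_add (by positivity) (by positivity),
      ← ENNReal.ofReal_add (by positivity) (by positivity)]
    congr 1; ring
  rw [e]
  refine (measure_mono h1).trans ?_
  refine (measure_union_le _ _).trans (add_le_add hA ?_)
  refine (measure_union_le _ _).trans (add_le_add hB ?_)
  refine (measure_union_le _ _).trans (add_le_add hC ?_)
  refine (measure_union_le _ _).trans (add_le_add hD ?_)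
  exact (measure_union_le _ _).trans (add_le_add hE hF)

theorem path_one {Ω : Type*} (X : ℕ → Ω → ℝ) (ω : Ω) (u : ℕ → ℝ) (n τ0 τe τ m : ℕ)
    (hX : ∀ t, 1 ≤ t → t < τe → X t ω = X (t - 1) ω + u t) (hτ0 : τ0 ≤ τ) (hτe : τ < τe)
    (hn : τ ≤ n) (hm1 : 1 ≤ m) (hm : m + m ≤ τ0) (K a s κ' r : ℝ)
    (ha : 0 < a) (hs : 0 < s) (hκ : 0 < κ') (hr : 0 < r)
    (h0 : |X 0 ω| < s) (hK : ∀ t ≤ n, |∑ i ∈ Finset.Icc 1 t, u i| < K * s)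
    (h5 : (m : ℝ) / 2 * (a ^ 2 * s ^ 2) < ∑ i ∈ Finset.range m,
      (∑ j ∈ Finset.Icc 1 (i + m), u j - ∑ j ∈ Finset.Icc 1 i, u j) ^ 2)
    (h4 : κ' * s ^ 2 < ∑ i ∈ Finset.Icc 1 τ0, u i ^ 2) (hrm : r * n ≤ m)
    (hbig : 18 * (K + 1) ^ 4 ≤ (min (r * a ^ 2 / 4) κ') ^ 2 * n) :
    svadfT X τ ω ≤ 5 * (K + 1) ^ 2 / min (r * a ^ 2 / 4) κ' := by
  have hXt : ∀ t < τe, X t ω = X 0 ω + ∑ i ∈ Finset.Icc 1 t, u i := by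
    intro t
    induction t with
    | zero => intro _; simp
    | succ t ih =>
      intro ht
      rw [hX (t + 1) (by omega) ht, Finset.sum_Icc_succ_top (by omega), Nat.add_sub_cancel,
        ih (by omega)]
      ring
  have hτ1 : 1 ≤ τ := by omega
  have hmin : 0 < min (r * a ^ 2 / 4) κ' := lt_min (by positivity) hκ
  refine T_upper X τ ω hτ1 n hn (K + 1) _ s hmin hs ?_ ?_ ?_ hbig
  · intro j hj
    rw [hXt j (by omega)]
    refine (abs_add_le _ _).trans ?_
    have := hK j (by omega)
    linarith
  · refine le_trans ?_ (SS_lower X τ ω hτ1 m (by omega))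
    have e : ∑ i ∈ Finset.range m, (X (i + m) ω - X i ω) ^ 2 = ∑ i ∈ Finset.range m,
      (∑ j ∈ Finset.Icc 1 (i + m), u j - ∑ j ∈ Finset.Icc 1 i, u j) ^ 2 := by
      refine Finset.sum_congr rfl fun i hi => ?_
      rw [Finset.mem_range] at hi
      rw [hXt (i + m) (by omega), hXt i (by omega)]
      ring
    rw [e]
    have h6 : min (r * a ^ 2 / 4) κ' * n * s ^ 2 ≤ r * a ^ 2 / 4 * n * s ^ 2 := by
      gcongr
      exact min_le_left _ _
    have h7 : r * n * (a ^ 2 * s ^ 2) ≤ m * (a ^ 2 * s ^ 2) := by gcongr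
    linarith
  · have h6 : min (r * a ^ 2 / 4) κ' * s ^ 2 ≤ κ' * s ^ 2 := by
      gcongr
      exact min_le_right _ _
    refine (h6.trans h4.le).trans ?_
    unfold DD
    have e : ∑ j ∈ Finset.Icc 1 τ, (X j ω - X (j - 1) ω) ^ 2 = ∑ j ∈ Finset.Icc 1 τ, u j ^ 2 := by
      refine Finset.sum_congr rfl fun j hj => ?_
      rw [Finset.mem_Icc] at hj
      rw [hX j hj.1 (by omega)]
      ring
    rw [e]
    exact Finset.sum_le_sum_of_subset_of_nonneg (Finset.Icc_subset_Icc_right hτ0)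
      (fun _ _ _ => sq_nonneg _)

variable {Ω : Type*} [mΩ : MeasurableSpace Ω]

theorem part_one (P : ℕ → Measure Ω) (hP : ∀ n, IsProbabilityMeasure (P n))
    (ℱ : ℕ → ℕ → MeasurableSpace Ω) (X σ ε : ℕ → ℕ → Ω → ℝ)
    (hGS : ∀ n, GS (P n) (ℱ n) n (σ n) (ε n)) (s : ℕ → ℝ) (hs : ∀ n, 1 ≤ n → 0 < s n)
    (hsum : ∀ n, 1 ≤ n → ∑ i ∈ Finset.Icc 1 n, ∫⁻ ω, ENNReal.ofReal (σ n i ω ^ 2) ∂(P n) ≤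
      ENNReal.ofReal (s n ^ 2))
    (hbr : ∀ η : ℝ, 0 < η → Tendsto (fun n : ℕ => P n {ω | ∃ k ≤ n,
      η < |(∑ t ∈ Finset.Icc 1 k, (σ n t ω) ^ 2) / s n ^ 2 - (k : ℝ) / n|}) atTop (nhds 0))
    (hin : Tendsto (fun n : ℕ => P n {ω | s n ≤ |X n 0 ω|}) atTop (nhds 0))
    (r0 re : ℝ) (hr0 : 0 < r0) (hre1 : re ≤ 1)
    (hX : ∀ (n t : ℕ) (ω : Ω), 1 ≤ t → t < ⌊(n : ℝ) * re⌋₊ → X n t ω = X n (t - 1) ω + σ n t ω * ε n t ω)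
    (hr01 : r0 ≤ 1)
    (cv : ℕ → ℝ) (hcv : Tendsto cv atTop atTop) (ε0 : ℝ) (hε0 : 0 < ε0) :
    ∀ᶠ n in atTop, P n {ω | ∃ τ, ⌊(n : ℝ) * r0⌋₊ ≤ τ ∧ τ < ⌊(n : ℝ) * re⌋₊ ∧
      cv n < svadfT (X n) τ ω} ≤ ENNReal.ofReal ε0 := by
  set K : ℝ := max 1 (6 / ε0) with hK
  have hK1 : 1 ≤ K := le_max_left _ _
  have hK2 : 6 / ε0 ≤ K := le_max_right _ _
  have hK3 : 1 / K ^ 2 ≤ ε0 / 6 := by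
    rw [div_le_iff₀ hε0] at hK2
    rw [div_le_div_iff₀ (by positivity) (by norm_num)]
    nlinarith
  set a : ℝ := ε0 * √(r0 / 4) / 36 with ha
  have hsq : 0 < √(r0 / 4) := Real.sqrt_pos.2 (by positivity)
  have ha0 : 0 < a := by positivity
  set η : ℝ := min (a ^ 2 / 2) (r0 / 8) with hη
  have hη0 : 0 < η := lt_min (by positivity) (by positivity)
  set θ : ℝ := (18 / ε0) ^ 2 / r0 with hθ
  have hθ0 : 0 < θ := by positivity
  set κ : ℝ := min (r0 / 4 * a ^ 2 / 4) (1 / θ) with hκ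
  have hκ0 : 0 < κ := lt_min (by positivity) (by positivity)
  have hev : ∀ᶠ n : ℕ in atTop, 18 * (K + 1) ^ 4 ≤ κ ^ 2 * n := by
    have := (tendsto_natCast_atTop_atTop (R := ℝ)).const_mul_atTop (show 0 < κ ^ 2 by positivity)
    exact this.eventually_ge_atTop _
  have hev2 : ∀ᶠ n : ℕ in atTop, (1 : ℝ) ≤ r0 / 4 * n := by
    have := (tendsto_natCast_atTop_atTop (R := ℝ)).const_mul_atTop (show 0 < r0 / 4 by positivity)
    exact this.eventually_ge_atTop _
  have hpos6 : (0 : ENNReal) < ENNReal.ofReal (ε0 / 6) := by simpa using by positivity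
  filter_upwards [hev, hev2, hcv.eventually_ge_atTop (5 * (K + 1) ^ 2 / κ),
    (hbr η hη0).eventually_le_const hpos6, hin.eventually_le_const hpos6,
    (floor_div_tendsto r0 hr0.le).eventually_const_lt (show 3 * r0 / 4 < r0 by linarith),
    eventually_ge_atTop 1] with n e1 e2 e3 e4 e5 e6 hn
  have hPn := hP n
  have hn0 : (0 : ℝ) < n := by exact_mod_cast hn
  set τ0 := ⌊(n : ℝ) * r0⌋₊ with hτ0
  obtain ⟨m, hm⟩ : ∃ m, m = τ0 / 2 := ⟨_, rfl⟩
  have hm2 : τ0 ≤ 2 * m + 1 := by omega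
  have hm2' : (τ0 : ℝ) ≤ 2 * m + 1 := by exact_mod_cast hm2
  rw [lt_div_iff₀ hn0] at e6
  have hrm : r0 / 4 * n ≤ m := by nlinarith
  have hm1 : 1 ≤ m := by
    have : (1 : ℝ) ≤ m := e2.trans hrm
    exact_mod_cast this
  have hτ0n : τ0 ≤ n := by
    apply Nat.floor_le_of_le
    nlinarith
  have hsn := hs n hn
  refine union6 (P n) _ _ _ _ _ _ ∅ ε0 hε0 ?_ e4 e5
    ((M1 (hGS n) (s n) hsn (hsum n hn) (fun _ => 1) (fun _ => zero_le_one) (fun _ => le_rfl) K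
      (by positivity)).trans (ENNReal.ofReal_le_ofReal hK3))
    ((M5 (hGS n) (s n) hsn m hm1 (by omega) a ha0
      (fun t ω => ∑ i ∈ Finset.Icc 1 t, σ n i ω * ε n i ω)
      (fun t ω => ∑ i ∈ Finset.Icc 1 t, σ n i ω ^ 2) (fun _ _ => rfl) (fun _ _ => rfl)).trans
      (ENNReal.ofReal_le_ofReal ?_))
    ((M4 (hGS n) (s n) hsn τ0 hτ0n (1 / θ) (r0 / 2) θ hθ0 (by positivity)).trans
      (ENNReal.ofReal_le_ofReal ?_)) (by simp)
  · rintro ω ⟨τ, t1, t2, t3⟩ g1 g2 g3 g4 g5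
    exfalso
    simp only [Set.mem_ofPred_eq, not_exists, not_and, not_le, not_lt, one_mul] at g1 g2 g3 g4 g5
    have hb : ∀ k ≤ n, |(∑ t ∈ Finset.Icc 1 k, (σ n t ω) ^ 2) / s n ^ 2 - (k : ℝ) / n| ≤ a ^ 2 / 2 :=
      fun k hk => (g1 k hk).trans (min_le_left _ _)
    have h5 : (m : ℝ) / 2 * (a ^ 2 * s n ^ 2) < ∑ i ∈ Finset.range m,
        (∑ j ∈ Finset.Icc 1 (i + m), σ n j ω * ε n j ω -
          ∑ j ∈ Finset.Icc 1 i, σ n j ω * ε n j ω) ^ 2 := by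
      by_contra hc
      push Not at hc
      exact g4 hc hb
    have h4 : 1 / θ * s n ^ 2 < ∑ i ∈ Finset.Icc 1 τ0, (σ n i ω * ε n i ω) ^ 2 := by
      by_contra hc
      push Not at hc
      have q1 := g5 hc
      have q2 := (g1 τ0 hτ0n).trans (min_le_right _ _)
      rw [abs_le] at q2
      have q3 : 3 * r0 / 4 < (τ0 : ℝ) / n := by rw [lt_div_iff₀ hn0]; exact e6
      linarith [q2.1]
    have hτn : τ ≤ n := by
      have : ⌊(n : ℝ) * re⌋₊ ≤ n := by
        apply Nat.floor_le_of_le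
        nlinarith
      omega
    have := path_one (X n) ω (fun i => σ n i ω * ε n i ω) n τ0 _ τ m (fun t ht1 ht2 => hX n t ω ht1 ht2)
      t1 t2 hτn hm1 (by omega) K a (s n) (1 / θ) (r0 / 4) ha0 hsn (by positivity) (by positivity)
      g2 g3 h5 h4 hrm e1
    linarith
  · have q1 : √(r0 / 4) ≤ √((m : ℝ) / n) := by
      apply Real.sqrt_le_sqrt
      rw [le_div_iff₀ hn0]; exact hrm
    calc 2 * (3 * a / √((m : ℝ) / n)) ≤ 2 * (3 * a / √(r0 / 4)) := by gcongr
      _ = ε0 / 6 := by rw [ha]; field_simp; norm_num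
  · have q1 : 18 / ε0 ≤ √(1 + 2 * θ * (r0 / 2)) := by
      apply Real.le_sqrt_of_sq_le
      have : 2 * θ * (r0 / 2) = (18 / ε0) ^ 2 := by rw [hθ]; field_simp
      rw [this]; linarith
    have q2 : Real.exp (θ * (1 / θ)) ≤ 3 := by
      rw [mul_one_div_cancel hθ0.ne']
      linarith [Real.exp_one_lt_d9]
    calc Real.exp (θ * (1 / θ)) / √(1 + 2 * θ * (r0 / 2)) ≤ 3 / (18 / ε0) := by gcongr
      _ = ε0 / 6 := by field_simp; norm_num

end partOne

section partTwo

theorem path_two {Ω : Type*} (X : ℕ → Ω → ℝ) (ω : Ω) (u w : ℕ → ℝ) (n τ k0 : ℕ) (φ : ℝ)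
    (hX : ∀ t, 1 ≤ t → t ≤ τ → X t ω = (if k0 < t then 1 + φ else 1) * X (t - 1) ω + u t)
    (hw : ∀ t, w t = ((1 + φ) ^ (t - k0))⁻¹)
    (hn : τ ≤ n) (h3 : 3 ≤ k0) (hk0τ : k0 ≤ τ) (K a s : ℝ) (hφ : 0 < φ) (hφ1 : φ ≤ 1)
    (ha : 0 < a) (hs : 0 < s) (hK1 : 1 ≤ K)
    (h0 : |X 0 ω| < s) (hK : ∀ t ≤ n, |∑ i ∈ Finset.Icc 1 t, w i * u i| < K * s)
    (h5 : a * s < |X 0 ω + ∑ i ∈ Finset.Icc 1 τ, w i * u i|)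
    (h4 : ∑ i ∈ Finset.Icc 1 n, u i ^ 2 < K * s ^ 2)
    (hne : u 3 * u 1 ≠ u 2 ^ 2)
    (hD : 3 * (n : ℝ) ≤ (1 + φ) ^ (τ - k0))
    (hc : 2 * (K + 1) ^ 2 / n + 2 * φ * (K + 1) ^ 2 + 4 * (K + 1) ^ 2 / (φ * τ) ≤ a ^ 2 / 4) :
    a ^ 2 / (24 * (K + 1) ^ 2) * (√φ * τ) ≤ svadfT X τ ω := by
  have hφp : 0 < 1 + φ := by linarith
  have hXt : ∀ t ≤ τ, X t ω = (1 + φ) ^ (t - k0) * (X 0 ω + ∑ i ∈ Finset.Icc 1 t, w i * u i) := by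
    intro t
    induction t with
    | zero => intro _; simp
    | succ t ih =>
      intro ht
      rw [hX (t + 1) (by omega) ht, Finset.sum_Icc_succ_top (by omega), Nat.add_sub_cancel,
        ih (by omega), hw (t + 1)]
      by_cases hk : k0 < t + 1
      · rw [if_pos hk, show t + 1 - k0 = (t - k0) + 1 by omega]
        field_simp
        ring
      · rw [if_neg hk, show t + 1 - k0 = 0 by omega, show t - k0 = 0 by omega]
        simp; ring
  refine T_lower X τ ω n k0 (by omega) hn φ (K + 1) a s hφ hφ1 (by linarith) ha hs
    (fun t => X 0 ω + ∑ i ∈ Finset.Icc 1 t, w i * u i) u hX hXt ?_ h5.le ?_ ?_ hD hc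
  · intro t ht
    refine (abs_add_le _ _).trans ?_
    have := hK t (by omega)
    linarith
  · have h6 : ∑ i ∈ Finset.Icc 1 τ, u i ^ 2 ≤ ∑ i ∈ Finset.Icc 1 n, u i ^ 2 :=
      Finset.sum_le_sum_of_subset_of_nonneg (Finset.Icc_subset_Icc_right hn)
        (fun _ _ _ => sq_nonneg _)
    have : 0 < s ^ 2 := by positivity
    linarith
  · refine sigma_pos X τ ω (by omega) u (fun j hj1 hj2 => ?_) hne
    rw [hX j hj1 (by omega), if_neg (by omega), one_mul]

theorem exp_grow (b α : ℝ) (hb : 0 < b) (hα : α < 1) :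
    ∀ᶠ n : ℕ in atTop, 3 * (n : ℝ) ≤ Real.exp (b * (n : ℝ) ^ (1 - α)) := by
  have h1 := tendsto_rpow_mul_exp_neg_mul_atTop_nhds_zero (1 / (1 - α)) b hb
  have h2 : Tendsto (fun n : ℕ => (n : ℝ) ^ (1 - α)) atTop atTop :=
    (tendsto_rpow_atTop (by linarith)).comp (tendsto_natCast_atTop_atTop (R := ℝ))
  filter_upwards [(h1.comp h2).eventually_lt_const (show (0 : ℝ) < 1 / 3 by norm_num)] with n hn
  simp only [Function.comp] at hn
  rw [← Real.rpow_mul (Nat.cast_nonneg n), mul_one_div_cancel (by linarith), Real.rpow_one, neg_mul,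
    Real.exp_neg, ← div_eq_mul_inv, div_lt_div_iff₀ (Real.exp_pos _) (by norm_num)] at hn
  linarith

theorem pow_grow (φ : ℝ) (hφ : 0 < φ) (hφ1 : φ ≤ 1) (m : ℕ) :
    Real.exp (m * (φ / 2)) ≤ (1 + φ) ^ m := by
  rw [Real.exp_nat_mul]
  gcongr
  have h1 := Real.one_sub_le_exp_neg (φ / 2)
  rw [Real.exp_neg] at h1
  have h2 : Real.exp (φ / 2) ≤ (1 - φ / 2)⁻¹ := by
    rw [le_inv_comm₀ (Real.exp_pos _) (by linarith)]
    exact h1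
  refine h2.trans ?_
  rw [inv_le_iff_one_le_mul₀ (by linarith)]
  nlinarith

variable {Ω : Type*} [mΩ : MeasurableSpace Ω]

set_option maxHeartbeats 2000000 in
theorem part_two (P : ℕ → Measure Ω) (hP : ∀ n, IsProbabilityMeasure (P n))
    (ℱ : ℕ → ℕ → MeasurableSpace Ω) (X σ ε : ℕ → ℕ → Ω → ℝ)
    (hσpos : ∀ n t, 1 ≤ t → t ≤ n → ∀ ω, 0 < σ n t ω)
    (hGS : ∀ n, GS (P n) (ℱ n) n (σ n) (ε n)) (hX0 : ∀ n, Measurable[ℱ n 0] (X n 0))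
    (s : ℕ → ℝ) (hs : ∀ n, 1 ≤ n → 0 < s n)
    (hsum : ∀ n, 1 ≤ n → ∑ i ∈ Finset.Icc 1 n, ∫⁻ ω, ENNReal.ofReal (σ n i ω ^ 2) ∂(P n) ≤
      ENNReal.ofReal (s n ^ 2))
    (hbr : ∀ η : ℝ, 0 < η → Tendsto (fun n : ℕ => P n {ω | ∃ k ≤ n,
      η < |(∑ t ∈ Finset.Icc 1 k, (σ n t ω) ^ 2) / s n ^ 2 - (k : ℝ) / n|}) atTop (nhds 0))
    (hin : Tendsto (fun n : ℕ => P n {ω | s n ≤ |X n 0 ω|}) atTop (nhds 0))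
    (re rf c α : ℝ) (hre : 0 < re) (hrf1 : rf ≤ 1) (hc : 0 < c) (hα0 : 0 < α) (hα : α < 1)
    (hX : ∀ (n t : ℕ) (ω : Ω), 1 ≤ t → t ≤ ⌊(n : ℝ) * rf⌋₊ → X n t ω =
      (if ⌊(n : ℝ) * re⌋₊ ≤ t then 1 + c * (n : ℝ) ^ (-α) else 1) * X n (t - 1) ω
        + σ n t ω * ε n t ω)
    (cv : ℕ → ℝ) (hcv : Tendsto (fun n : ℕ => cv n / (n : ℝ) ^ (1 - α / 2)) atTop (nhds 0))
    (ε0 : ℝ) (hε0 : 0 < ε0) (η1 : ℝ) (hη1 : 0 < η1) (hη1f : re + η1 ≤ rf) :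
    ∃ η, 0 < η ∧ η ≤ η1 ∧ ∀ᶠ n in atTop,
      P n {ω | svadfT (X n) ⌊(n : ℝ) * (re + η)⌋₊ ω ≤ cv n} ≤ ENNReal.ofReal ε0 := by
  set K : ℝ := max 1 (6 / ε0) with hK
  have hK1 : 1 ≤ K := le_max_left _ _
  have hK2 : 6 / ε0 ≤ K := le_max_right _ _
  have hK4 : 1 / K ≤ ε0 / 6 := by
    rw [div_le_iff₀ hε0] at hK2
    rw [div_le_div_iff₀ (by positivity) (by norm_num)]
    linarith
  have hK3 : 1 / K ^ 2 ≤ ε0 / 6 := by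
    refine le_trans ?_ hK4
    apply one_div_le_one_div_of_le (by positivity)
    nlinarith
  set a : ℝ := ε0 * √re / 18 with ha
  have hsq : 0 < √re := Real.sqrt_pos.2 hre
  have ha0 : 0 < a := by positivity
  set η : ℝ := min η1 (a ^ 2 / 3) with hη
  have hη0 : 0 < η := lt_min hη1 (by positivity)
  have hηa : η ≤ a ^ 2 / 3 := min_le_right _ _
  have hηη1 : η ≤ η1 := min_le_left _ _
  refine ⟨η, hη0, hηη1, ?_⟩
  have hnat := tendsto_natCast_atTop_atTop (R := ℝ)
  -- asymptotics
  have hφ0 : Tendsto (fun n : ℕ => c * (n : ℝ) ^ (-α)) atTop (nhds 0) := by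
    simpa using ((tendsto_rpow_neg_atTop hα0).comp hnat).const_mul c
  have hτn := floor_div_tendsto (re + η) (by positivity)
  have hen := floor_div_tendsto re hre.le
  have hpw : Tendsto (fun n : ℕ => (n : ℝ) ^ (1 - α)) atTop atTop :=
    (tendsto_rpow_atTop (by linarith)).comp hnat
  have hφτ : Tendsto (fun n : ℕ => c * (n : ℝ) ^ (-α) * (⌊(n : ℝ) * (re + η)⌋₊ : ℝ)) atTop atTop := by
    have h1 := (hpw.const_mul_atTop hc).atTop_mul_pos (by positivity) hτn
    refine h1.congr' ?_
    filter_upwards [eventually_gt_atTop 0] with n hn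
    have hn0 : (0 : ℝ) < n := by exact_mod_cast hn
    rw [sub_eq_add_neg, Real.rpow_add hn0, Real.rpow_one]
    field_simp
  have hcond : Tendsto (fun n : ℕ => 2 * (K + 1) ^ 2 / (n : ℝ) + 2 * (c * (n : ℝ) ^ (-α)) * (K + 1) ^ 2
      + 4 * (K + 1) ^ 2 / (c * (n : ℝ) ^ (-α) * (⌊(n : ℝ) * (re + η)⌋₊ : ℝ))) atTop (nhds 0) := by
    have h1 : Tendsto (fun n : ℕ => 2 * (K + 1) ^ 2 / (n : ℝ)) atTop (nhds 0) :=
      hnat.const_div_atTop _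
    have h2 : Tendsto (fun n : ℕ => 2 * (c * (n : ℝ) ^ (-α)) * (K + 1) ^ 2) atTop (nhds 0) := by
      simpa using (hφ0.const_mul 2).mul_const ((K + 1) ^ 2)
    have h3 := hφτ.const_div_atTop (4 * (K + 1) ^ 2)
    simpa using (h1.add h2).add h3
  have hpos6 : (0 : ENNReal) < ENNReal.ofReal (ε0 / 6) := by simpa using by positivity
  have hbig : ∀ᶠ n : ℕ in atTop, 4 ≤ (n : ℝ) * (re / 2) ∧ 2 ≤ (n : ℝ) * (η / 2) := by
    have h1 := (hnat.atTop_mul_const (show 0 < re / 2 by positivity)).eventually_ge_atTop 4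
    have h2 := (hnat.atTop_mul_const (show 0 < η / 2 by positivity)).eventually_ge_atTop 2
    exact h1.and h2
  filter_upwards [(hbr η hη0).eventually_le_const hpos6, hin.eventually_le_const hpos6,
    hφ0.eventually_le_const zero_lt_one, hcond.eventually_le_const (show 0 < a ^ 2 / 4 by positivity),
    exp_grow (c * η / 4) α (by positivity) hα, hbig,
    hτn.eventually_const_lt (show re + η / 2 < re + η by linarith),
    hen.eventually_const_lt (show max (re / 2) (re - η / 2) < re from max_lt (by linarith) (by linarith)),
    hcv.eventually_lt_const (show 0 < a ^ 2 / (24 * (K + 1) ^ 2) * (√c * re) by positivity),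
    eventually_ge_atTop 1] with n e1 e2 e3 e4 e5 e6 e7 e8 e9 hn
  have hPn := hP n
  have hn0 : (0 : ℝ) < n := by exact_mod_cast hn
  have hsn := hs n hn
  set φ : ℝ := c * (n : ℝ) ^ (-α) with hφ
  have hφpos : 0 < φ := by positivity
  set τ := ⌊(n : ℝ) * (re + η)⌋₊ with hτ
  set τe := ⌊(n : ℝ) * re⌋₊ with hτe
  have e8a : (n : ℝ) * (re / 2) < τe := by
    have := (le_max_left _ _).trans_lt e8
    rw [lt_div_iff₀ hn0] at this; linarith
  have e8b : re - η / 2 < (τe : ℝ) / n := (le_max_right _ _).trans_lt e8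
  have hτe4 : 4 < τe := by
    have : (4 : ℝ) < τe := e6.1.trans_lt e8a
    exact_mod_cast this
  obtain ⟨k0, hk0⟩ : ∃ k, k + 1 = τe := ⟨τe - 1, by omega⟩
  have hk0r : (k0 : ℝ) + 1 = τe := by exact_mod_cast hk0
  have hτeτ : τe ≤ τ := by
    apply Nat.floor_le_floor
    gcongr; linarith
  have hτrf : τ ≤ ⌊(n : ℝ) * rf⌋₊ := by
    apply Nat.floor_le_floor
    gcongr; linarith
  have hτn' : τ ≤ n := by
    apply Nat.floor_le_of_le
    nlinarith
  have hτle : (τ : ℝ) / n ≤ re + η := by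
    rw [div_le_iff₀ hn0]
    have := Nat.floor_le (show 0 ≤ (n : ℝ) * (re + η) by positivity)
    linarith
  have hτele : (τe : ℝ) ≤ n * re := Nat.floor_le (by positivity)
  have hk0n : re - η < (k0 : ℝ) / n := by
    rw [lt_div_iff₀ hn0] at e8b ⊢
    nlinarith [e6.2]
  have hτk : (n : ℝ) * (η / 2) ≤ ((τ - k0 : ℕ) : ℝ) := by
    rw [Nat.cast_sub (by omega)]
    rw [lt_div_iff₀ hn0] at e7
    linarith
  have hD : 3 * (n : ℝ) ≤ (1 + φ) ^ (τ - k0) := by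
    refine (e5.trans ?_).trans (pow_grow φ hφpos e3 _)
    apply Real.exp_le_exp.2
    have h1 : c * η / 4 * (n : ℝ) ^ (1 - α) = (n : ℝ) * (η / 2) * (φ / 2) := by
      rw [hφ, sub_eq_add_neg, Real.rpow_add hn0, Real.rpow_one]
      ring
    rw [h1]
    gcongr
  set w : ℕ → ℝ := fun t => ((1 + φ) ^ (t - k0))⁻¹ with hw
  have hw0 : ∀ i, 0 ≤ w i := fun i => by positivity
  have hw1 : ∀ i, w i ≤ 1 := fun i => inv_le_one_of_one_le₀ (one_le_pow₀ (by linarith))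
  refine union6 (P n) _ _ _ _ _ _ _ ε0 hε0 ?_ e1 e2
    ((M1 (hGS n) (s n) hsn (hsum n hn) w hw0 hw1 K
      (by positivity)).trans (ENNReal.ofReal_le_ofReal hK3))
    ((M3 (hGS n) (s n) hsn τ hτn' w (X n 0) (hX0 n) a re ha0 hre).trans
      (ENNReal.ofReal_le_ofReal ?_))
    ((M2 (hGS n) (s n) hsn (hsum n hn) K (by positivity)).trans
      (ENNReal.ofReal_le_ofReal hK4))
    (((hGS n).null (by omega) (hσpos n)).le.trans (by simp))
  · rintro ω hω g1 g2 g3 g4 g5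
    by_contra g6
    simp only [Set.mem_ofPred_eq, not_exists, not_and, not_le, not_lt] at hω g1 g2 g3 g4 g5 g6
    have h5 : a * s n < |X n 0 ω + ∑ i ∈ Finset.Icc 1 τ, w i * (σ n i ω * ε n i ω)| := by
      by_contra hcon
      push Not at hcon
      have q := g4 hcon
      have s2 : 0 < s n ^ 2 := by positivity
      have up : (∑ i ∈ Finset.Icc 1 τ, w i ^ 2 * σ n i ω ^ 2) / s n ^ 2 ≤
          (∑ i ∈ Finset.Icc 1 τ, σ n i ω ^ 2) / s n ^ 2 := by
        gcongr with i hi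
        have : w i ^ 2 ≤ 1 := pow_le_one₀ (hw0 i) (hw1 i)
        nlinarith [sq_nonneg (σ n i ω)]
      have lo : (∑ i ∈ Finset.Icc 1 k0, σ n i ω ^ 2) / s n ^ 2 ≤
          (∑ i ∈ Finset.Icc 1 τ, w i ^ 2 * σ n i ω ^ 2) / s n ^ 2 := by
        gcongr
        have e : ∑ i ∈ Finset.Icc 1 k0, σ n i ω ^ 2 = ∑ i ∈ Finset.Icc 1 k0, w i ^ 2 * σ n i ω ^ 2 := by
          refine Finset.sum_congr rfl fun i hi => ?_
          rw [Finset.mem_Icc] at hi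
          simp only [hw]
          rw [show i - k0 = 0 by omega]
          simp
        rw [e]
        exact Finset.sum_le_sum_of_subset_of_nonneg (Finset.Icc_subset_Icc_right (by omega))
          (fun _ _ _ => by positivity)
      have b1 := abs_le.1 (g1 τ hτn')
      have b2 := abs_le.1 (g1 k0 (by omega))
      have : |(∑ i ∈ Finset.Icc 1 τ, w i ^ 2 * σ n i ω ^ 2) / s n ^ 2 - re| ≤ a ^ 2 := by
        rw [abs_le]
        constructor
        · linarith [b2.1]
        · linarith [b1.2]
      linarith
    have hT := path_two (X n) ω (fun i => σ n i ω * ε n i ω) w n τ k0 φ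
      (fun t ht1 ht2 => by
        rw [hX n t ω ht1 (by omega)]
        have : (τe ≤ t) ↔ k0 < t := by omega
        simp only [← hτe, ← hφ, this])
      (fun _ => rfl) hτn' (by omega) (by omega) K a (s n) hφpos e3 ha0 hsn hK1 g2 g3 h5 g5 g6 hD e4
    have hsqrt : √φ * τ = √c * (τ / n) * (n : ℝ) ^ (1 - α / 2) := by
      have h1 : √φ = √c * (n : ℝ) ^ (-(α / 2)) := by
        rw [hφ, Real.sqrt_mul hc.le, Real.sqrt_eq_rpow ((n : ℝ) ^ (-α)), ← Real.rpow_mul hn0.le]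
        congr 2; ring
      rw [h1, sub_eq_add_neg, Real.rpow_add hn0, Real.rpow_one]
      field_simp
    have hp : 0 < (n : ℝ) ^ (1 - α / 2) := by positivity
    rw [div_lt_iff₀ hp] at e9
    have h8 : a ^ 2 / (24 * (K + 1) ^ 2) * (√c * re) * (n : ℝ) ^ (1 - α / 2) ≤
        a ^ 2 / (24 * (K + 1) ^ 2) * (√φ * τ) := by
      rw [hsqrt, mul_assoc]
      gcongr
      linarith
    linarith
  · rw [ha]
    apply le_of_eq
    field_simp
    norm_num

end partTwo

/-- Theorem 3, part 2 (consistent origination dating, t-type statistic): in the bubble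
model, under Assumptions A1, A2 and the initial-value condition, if the positive
thresholds satisfy `1/cv_n + cv_n/n^{1-α/2} → 0`, then the estimated origination
fraction `r̂_e` based on `SV-ADF^t` converges in probability to `r_e`. -/
theorem stmt3
    {Ω : Type*} [MeasurableSpace Ω]
    (P : ℕ → Measure Ω) (hP : ∀ n, IsProbabilityMeasure (P n))
    (ℱ : ℕ → ℕ → MeasurableSpace Ω) (hℱmono : ∀ n, Monotone (ℱ n))
    (hℱle : ∀ n t, ℱ n t ≤ ‹MeasurableSpace Ω›)
    (X σ ε : ℕ → ℕ → Ω → ℝ)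
    (hX0meas : ∀ n, Measurable[ℱ n 0] (X n 0))
    (hσpos : ∀ n t, 1 ≤ t → t ≤ n → ∀ ω, 0 < σ n t ω)
    (hσmeas : ∀ n t, 1 ≤ t → t ≤ n → Measurable[ℱ n (t - 1)] (σ n t))
    (hσint : ∀ n t, 1 ≤ t → t ≤ n → Integrable (fun ω => (σ n t ω) ^ 2) (P n))
    (hεmeas : ∀ n t, Measurable (ε n t))
    (hεgauss : ∀ n t, 1 ≤ t → t ≤ n → Measure.map (ε n t) (P n) = gaussianReal 0 1)
    (hεindep : ∀ n t, 1 ≤ t → t ≤ n →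
      Indep (MeasurableSpace.comap (ε n t) inferInstance) (ℱ n (t - 1)) (P n))
    (huadapted : ∀ n t, 1 ≤ t → t ≤ n →
      Measurable[ℱ n t] (fun ω => σ n t ω * ε n t ω))
    -- bubble model parameters
    (r0 re rf c α : ℝ)
    (hr0 : 0 < r0) (hr0e : r0 < re) (href : re < rf) (hrf1 : rf < 1)
    (hc : 0 < c) (hα : α ∈ Set.Ioo (0 : ℝ) 1)
    -- model equations
    (hmodel : ∀ n t, 1 ≤ t → t ≤ n → ∀ ω,
      X n t ω = (if ⌊(n : ℝ) * re⌋₊ ≤ t ∧ t ≤ ⌊(n : ℝ) * rf⌋₊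
          then 1 + c * (n : ℝ) ^ (-α) else 1) * X n (t - 1) ω + σ n t ω * ε n t ω)
    -- Assumption A1
    (hA1 : ∀ r ∈ Set.Ioc (0 : ℝ) 1, ∀ εp : ℝ, 0 < εp →
      Tendsto (fun n : ℕ => P n {ω |
          εp ≤ |(∑ t ∈ Finset.Icc 1 ⌊(n : ℝ) * r⌋₊, (σ n t ω) ^ 2) /
            ((⌊(n : ℝ) * r⌋₊ : ℝ) * avgVar P σ n ⌊(n : ℝ) * r⌋₊) - 1|})
        atTop (nhds 0))
    -- Assumption A2
    (hA2 : ∃ ζ ∈ Set.Ioo (0 : ℝ) 1, ∃ g : ℕ → ℝ,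
      g =o[atTop] (fun n : ℕ => (n : ℝ) ^ (-(1 : ℝ) / 2)) ∧
      ∀ n t : ℕ, (n : ℝ) ^ ζ < (t : ℝ) → t ≤ n →
        |avgVar P σ n t / avgVar P σ n n - 1| ≤ g n)
    -- initial-value condition
    (hinit : ∀ εp : ℝ, 0 < εp →
      Tendsto (fun n : ℕ => P n {ω |
          εp ≤ |X n 0 ω / Real.sqrt ((n : ℝ) * avgVar P σ n n)|})
        atTop (nhds 0))
    -- thresholds
    (cv : ℕ → ℝ) (hcvpos : ∀ n, 0 < cv n)
    (hcv : Tendsto (fun n : ℕ => 1 / cv n + cv n / (n : ℝ) ^ (1 - α / 2))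
      atTop (nhds 0)) :
    ∀ εp : ℝ, 0 < εp →
      Tendsto (fun n : ℕ => P n {ω |
          εp ≤ |rHatE (fun τ => svadfT (X n) τ) n r0 (cv n) ω - re|})
        atTop (nhds 0) := by
  intro εp hεp
  have hGS : ∀ n, GS (P n) (ℱ n) n (σ n) (ε n) := fun n =>
    ⟨hℱmono n, hℱle n, hσmeas n, hεmeas n, hεgauss n, hεindep n, huadapted n⟩
  set s : ℕ → ℝ := fun n => Real.sqrt ((n : ℝ) * avgVar P σ n n) with hsdef
  have hs2pos : ∀ n : ℕ, 1 ≤ n → 0 < (n : ℝ) * avgVar P σ n n := by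
    intro n hn
    rw [avgVar_mul P σ hn]
    exact sum_var_pos P σ hP hσpos hσint hn le_rfl
  have hs : ∀ n, 1 ≤ n → 0 < s n := fun n hn => Real.sqrt_pos.2 (hs2pos n hn)
  have hssq : ∀ n : ℕ, 1 ≤ n → s n ^ 2 = (n : ℝ) * avgVar P σ n n := fun n hn =>
    Real.sq_sqrt (hs2pos n hn).le
  have hsum : ∀ n, 1 ≤ n → ∑ i ∈ Finset.Icc 1 n, ∫⁻ ω, ENNReal.ofReal (σ n i ω ^ 2) ∂(P n) ≤
      ENNReal.ofReal (s n ^ 2) := by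
    intro n hn
    rw [hssq n hn, avgVar_mul P σ hn,
      ENNReal.ofReal_sum_of_nonneg (fun i _ => integral_nonneg fun ω => sq_nonneg _)]
    refine Finset.sum_le_sum fun i hi => ?_
    rw [Finset.mem_Icc] at hi
    rw [ofReal_integral_eq_lintegral_ofReal (hσint n i hi.1 hi.2)
      (Eventually.of_forall fun ω => sq_nonneg _)]
  have hbr : ∀ η : ℝ, 0 < η → Tendsto (fun n : ℕ => P n {ω | ∃ k ≤ n,
      η < |(∑ t ∈ Finset.Icc 1 k, (σ n t ω) ^ 2) / s n ^ 2 - (k : ℝ) / n|}) atTop (nhds 0) := by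
    intro η hη
    refine (bracket_unif P σ hP hσpos hσint
      (fun r hr η hη => bracket_pt P σ hP hσpos hσint hA1 hA2 r hr η hη) η hη).congr' ?_
    filter_upwards [eventually_ge_atTop 1] with n hn
    rw [hssq n hn]
  have hin : Tendsto (fun n : ℕ => P n {ω | s n ≤ |X n 0 ω|}) atTop (nhds 0) := by
    refine (hinit 1 one_pos).congr' ?_
    filter_upwards [eventually_ge_atTop 1] with n hn
    congr 1
    ext ω
    change 1 ≤ |X n 0 ω / s n| ↔ s n ≤ |X n 0 ω|
    rw [abs_div, abs_of_pos (hs n hn), one_le_div (hs n hn)]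
  -- thresholds
  have hcvinv : Tendsto (fun n : ℕ => (cv n)⁻¹) atTop (nhds 0) := by
    refine tendsto_of_tendsto_of_tendsto_of_le_of_le tendsto_const_nhds hcv
      (fun n => inv_nonneg.2 (hcvpos n).le) (fun n => ?_)
    have h1 := hcvpos n
    have h2 : 0 ≤ cv n / (n : ℝ) ^ (1 - α / 2) := by positivity
    simp only [one_div]
    linarith
  have hcvtop : Tendsto cv atTop atTop := by
    have h1 : Tendsto (fun n : ℕ => (cv n)⁻¹) atTop (nhdsWithin 0 (Set.Ioi 0)) :=
      tendsto_nhdsWithin_iff.2 ⟨hcvinv, Eventually.of_forall fun n => inv_pos.2 (hcvpos n)⟩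
    exact h1.inv_tendsto_nhdsGT_zero.congr fun n => by simp
  have hcv2 : Tendsto (fun n : ℕ => cv n / (n : ℝ) ^ (1 - α / 2)) atTop (nhds 0) := by
    refine tendsto_of_tendsto_of_tendsto_of_le_of_le tendsto_const_nhds hcv
      (fun n => ?_) (fun n => ?_)
    · have h1 := hcvpos n
      positivity
    · have h1 : 0 < 1 / cv n := one_div_pos.2 (hcvpos n)
      simp only
      linarith
  have hnfl : ∀ (n : ℕ) (r : ℝ), r ≤ 1 → ⌊(n : ℝ) * r⌋₊ ≤ n := by
    intro n r hr
    apply Nat.floor_le_of_le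
    have : (0 : ℝ) ≤ n := Nat.cast_nonneg n
    nlinarith
  have key : ∀ ε0 : ℝ, 0 < ε0 → ∀ᶠ n in atTop, P n {ω |
      εp ≤ |rHatE (fun τ => svadfT (X n) τ) n r0 (cv n) ω - re|} ≤ ENNReal.ofReal ε0 := by
    intro ε0 hε0
    have h1 := part_one P hP ℱ X σ ε hGS s hs hsum hbr hin r0 re hr0 (by linarith)
      (fun n t ω ht1 ht2 => by
        rw [hmodel n t ht1 (by have := hnfl n re (by linarith); omega) ω, if_neg (by omega), one_mul])
      (by linarith) cv hcvtop (ε0 / 2) (by positivity)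
    obtain ⟨η, hη0, hη1, h2⟩ := part_two P hP ℱ X σ ε hσpos hGS hX0meas s hs hsum hbr hin re rf c α
      (by linarith) hrf1.le hc hα.1 hα.2
      (fun n t ω ht1 ht2 => by
        rw [hmodel n t ht1 (by have := hnfl n rf (by linarith); omega) ω]
        simp only [ht2, and_true])
      cv hcv2 (ε0 / 2) (by positivity) (min (εp / 2) (rf - re))
      (lt_min (by positivity) (by linarith)) (by linarith [min_le_right (εp / 2) (rf - re)])
    have hηε : η ≤ εp / 2 := hη1.trans (min_le_left _ _)
    have hηf : η ≤ rf - re := hη1.trans (min_le_right _ _)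
    have hbig := ((tendsto_natCast_atTop_atTop (R := ℝ)).atTop_mul_const
      (show 0 < εp / 2 by positivity)).eventually_ge_atTop 1
    filter_upwards [h1, h2, hbig] with n h1 h2 h3
    have e : ENNReal.ofReal ε0 = ENNReal.ofReal (ε0 / 2) + ENNReal.ofReal (ε0 / 2) := by
      rw [← ENNReal.ofReal_add (by positivity) (by positivity), add_halves]
    rw [e]
    refine le_trans ((measure_mono ?_).trans (measure_union_le _ _)) (add_le_add h1 h2)
    intro ω hω
    by_contra hcon
    rw [Set.mem_union, not_or] at hcon
    obtain ⟨g1, g2⟩ := hcon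
    simp only [Set.mem_ofPred_eq, not_exists, not_and, not_le, not_lt] at hω g1 g2
    have hn0 : (0 : ℝ) ≤ n := Nat.cast_nonneg n
    have hlow : ∀ x ∈ ({s : ℝ | s ∈ Set.Icc r0 1 ∧ cv n < svadfT (X n) ⌊(n : ℝ) * s⌋₊ ω} ∪ {1}),
        re - εp / 2 ≤ x := by
      rintro x (⟨hx1, hx2⟩ | hx)
      · by_contra hlt
        push Not at hlt
        have q1 : ⌊(n : ℝ) * r0⌋₊ ≤ ⌊(n : ℝ) * x⌋₊ :=
          Nat.floor_le_floor (mul_le_mul_of_nonneg_left hx1.1 hn0)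
        have q2 : ⌊(n : ℝ) * x⌋₊ < ⌊(n : ℝ) * re⌋₊ := by
          have hx0 : 0 ≤ (n : ℝ) * x := mul_nonneg hn0 (by linarith [hx1.1])
          rw [← Nat.succ_le_iff, Nat.succ_eq_add_one]
          apply Nat.le_floor
          push_cast
          have := Nat.floor_le hx0
          nlinarith
        linarith [g1 _ q1 q2]
      · rw [Set.mem_singleton_iff] at hx
        linarith
    have hub : rHatE (fun τ => svadfT (X n) τ) n r0 (cv n) ω ≤ re + η := by
      refine csInf_le ⟨re - εp / 2, hlow⟩ (Or.inl ⟨⟨by linarith, by linarith⟩, g2⟩)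
    have hlb : re - εp / 2 ≤ rHatE (fun τ => svadfT (X n) τ) n r0 (cv n) ω :=
      le_csInf ⟨1, Or.inr rfl⟩ hlow
    have : |rHatE (fun τ => svadfT (X n) τ) n r0 (cv n) ω - re| ≤ εp / 2 := by
      rw [abs_le]
      constructor <;> linarith
    linarith
  rw [ENNReal.tendsto_nhds_zero]
  intro δ hδ
  rcases eq_or_ne δ ⊤ with h | h
  · subst h
    exact Eventually.of_forall fun n => le_top
  · have := key δ.toReal (ENNReal.toReal_pos hδ.ne' h)
    rwa [ENNReal.ofReal_toReal h] at this
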